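/- arXiv:math/0304205 — 2 statements merged into one kernel-verified Lean document; each statement's English description precedes it below -/
import Mathlib

section
/- Let G be a simple graph on vertex set ℕ satisfying the extension property, and let H be a subgroup of the automorphism group Aut(G). If the index of H in Aut(G) is strictly less than 2^ℵ₀, then there exists a finite set A ⊆ ℕ such that the pointwise stabilizer of A is contained in H. -/
/-- A simple graph on `ℕ` has the extension property (i.e. is a Rado graph) if for all
disjoint finite sets `A`, `B` of vertices there is a vertex outside `A ∪ B` adjacent to
every vertex of `A` and to no vertex of `B`. -/
def SimpleGraph.ExtensionProperty (G : SimpleGraph ℕ) : Prop :=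
  ∀ A B : Finset ℕ, Disjoint A B →
    ∃ v : ℕ, v ∉ A ∪ B ∧ (∀ a ∈ A, G.Adj v a) ∧ ∀ b ∈ B, ¬G.Adj v b

section

namespace SIP

theorem one_point {G : SimpleGraph ℕ} (hG : G.ExtensionProperty) (S : Finset ℕ) (P : ℕ → Prop) :
    ∃ v, v ∉ S ∧ ∀ s ∈ S, (G.Adj v s ↔ P s) := by
  classical
  obtain ⟨v, hv, h1, h2⟩ := hG (S.filter P) (S.filter (fun s => ¬ P s))
    (Finset.disjoint_filter_filter_not S S P)
  rw [Finset.filter_union_filter_not_eq] at hv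
  refine ⟨v, hv, fun s hs => ?_⟩
  by_cases hp : P s
  · simp [hp, h1 s (by simp [hs, hp])]
  · simp [hp, h2 s (by simp [hs, hp])]

/-- `h` is an embedding on the set `C` of vertices. -/
def PEmb {β : Type} (Γ : SimpleGraph β) (G : SimpleGraph ℕ) (C : Finset β) (h : β → ℕ) : Prop :=
  ∀ x ∈ C, ∀ y ∈ C, (h x = h y → x = y) ∧ (G.Adj (h x) (h y) ↔ Γ.Adj x y)

theorem emb_one {G : SimpleGraph ℕ} (hG : G.ExtensionProperty) {β : Type} [DecidableEq β]
    (Γ : SimpleGraph β) (s : Finset β) (e : β → ℕ) (he : PEmb Γ G s e) (t : β) :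
    ∃ v : ℕ, v ∉ s.image e ∧ ∀ x ∈ s, (G.Adj v (e x) ↔ Γ.Adj t x) := by
  obtain ⟨v, hv, h⟩ := one_point hG (s.image e) (fun y => ∃ x ∈ s, e x = y ∧ Γ.Adj t x)
  refine ⟨v, hv, fun x hx => ?_⟩
  rw [h _ (Finset.mem_image_of_mem e hx)]
  constructor
  · rintro ⟨x', hx', h1, h2⟩
    rwa [← (he x' hx' x hx).1 h1]
  · intro h2
    exact ⟨x, hx, rfl, h2⟩

theorem pemb_insert {G : SimpleGraph ℕ} {β : Type} [DecidableEq β]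
    {Γ : SimpleGraph β} {s : Finset β} {e e' : β → ℕ} (he : PEmb Γ G s e) {t : β}
    (hee : ∀ x ∈ s, e' x = e x) (hv : e' t ∉ s.image e)
    (h : ∀ x ∈ s, (G.Adj (e' t) (e x) ↔ Γ.Adj t x)) : PEmb Γ G (insert t s) e' := by
  have hv' : ∀ x ∈ s, e x ≠ e' t := by
    intro x hx h1
    exact hv (Finset.mem_image.2 ⟨x, hx, h1⟩)
  intro x hx y hy
  rw [Finset.mem_insert] at hx hy
  rcases hx with rfl | hx <;> rcases hy with rfl | hy
  · simp
  · rw [hee y hy]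
    exact ⟨fun h1 => absurd h1.symm (hv' y hy), h y hy⟩
  · rw [hee x hx]
    refine ⟨fun h1 => absurd h1 (hv' x hx), ?_⟩
    rw [G.adj_comm, Γ.adj_comm]
    exact h x hx
  · rw [hee x hx, hee y hy]
    exact he x hx y hy

theorem emb {G : SimpleGraph ℕ} (hG : G.ExtensionProperty) {β : Type} [DecidableEq β]
    (Γ : SimpleGraph β) (s T : Finset β) (e : β → ℕ) (he : PEmb Γ G s e) :
    ∃ e' : β → ℕ, (∀ x ∈ s, e' x = e x) ∧ PEmb Γ G (T ∪ s) e' := by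
  induction T using Finset.induction_on with
  | empty => exact ⟨e, fun _ _ => rfl, by simpa using he⟩
  | insert t T _ ih =>
    obtain ⟨e', h1, h2⟩ := ih
    by_cases ht : t ∈ T ∪ s
    · refine ⟨e', h1, ?_⟩
      rwa [Finset.insert_union, Finset.insert_eq_of_mem ht]
    · obtain ⟨v, hv, h⟩ := emb_one hG Γ (T ∪ s) e' h2 t
      have hne : ∀ x ∈ T ∪ s, Function.update e' t v x = e' x := by
        intro x hx
        rw [Function.update_of_ne]
        rintro rfl
        exact ht hx
      refine ⟨Function.update e' t v, ?_, ?_⟩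
      · intro x hx
        rw [hne x (Finset.mem_union_right _ hx), h1 x hx]
      · rw [Finset.insert_union]
        refine pemb_insert h2 hne ?_ ?_
        · simpa using hv
        · simpa using h

theorem seqlim (h : ℕ → Equiv.Perm ℕ) (h1 : ∀ n x, x ≤ n → h (n+1) x = h n x)
    (h2 : ∀ n x, x ≤ n → (h (n+1)).symm x = (h n).symm x) :
    ∃ k : Equiv.Perm ℕ, ∀ x n, x ≤ n → k x = h n x := by
  have h1' : ∀ x n, x ≤ n → h n x = h x x := by
    intro x n hn
    induction n, hn using Nat.le_induction with
    | base => rfl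
    | succ n hn ih => rw [h1 n x hn, ih]
  have h2' : ∀ x n, x ≤ n → (h n).symm x = (h x).symm x := by
    intro x n hn
    induction n, hn using Nat.le_induction with
    | base => rfl
    | succ n hn ih => rw [h2 n x hn, ih]
  refine ⟨⟨fun x => h x x, fun x => (h x).symm x, ?_, ?_⟩, ?_⟩
  · intro x
    show (h (h x x)).symm (h x x) = x
    rw [← h2' (h x x) (max x (h x x)) (le_max_right _ _), Equiv.symm_apply_eq]
    exact (h1' x (max x (h x x)) (le_max_left _ _)).symm
  · intro x
    show (h ((h x).symm x)) ((h x).symm x) = x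
    rw [← h1' ((h x).symm x) (max x ((h x).symm x)) (le_max_right _ _),
      ← Equiv.eq_symm_apply]
    exact (h2' x (max x ((h x).symm x)) (le_max_left _ _)).symm
  · intro x n hn
    exact (h1' x n hn).symm

theorem lim (Q : Finset ℕ → Equiv.Perm ℕ → Prop)
    (forth : ∀ C h, Q C h → ∀ x, ∃ C' h', Q C' h' ∧ C ⊆ C' ∧ (∀ c ∈ C, h' c = h c) ∧ x ∈ C')
    (back : ∀ C h, Q C h → ∀ x, ∃ C' h', Q C' h' ∧ C ⊆ C' ∧ (∀ c ∈ C, h' c = h c) ∧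
      ∃ c ∈ C', h' c = x)
    (C0 : Finset ℕ) (h0 : Equiv.Perm ℕ) (hQ : Q C0 h0) :
    ∃ k : Equiv.Perm ℕ, (∀ c ∈ C0, k c = h0 c) ∧
      ∀ F : Finset ℕ, ∃ C h, F ⊆ C ∧ Q C h ∧ ∀ c ∈ C, k c = h c := by
  have both : ∀ (p : {p : Finset ℕ × Equiv.Perm ℕ // Q p.1 p.2}) (x : ℕ),
      ∃ p' : {p : Finset ℕ × Equiv.Perm ℕ // Q p.1 p.2}, p.1.1 ⊆ p'.1.1 ∧
        (∀ c ∈ p.1.1, p'.1.2 c = p.1.2 c) ∧ x ∈ p'.1.1 ∧ ∃ c ∈ p'.1.1, p'.1.2 c = x := by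
    rintro ⟨⟨C, h⟩, hp⟩ x
    obtain ⟨C1, k1, q1, s1, a1, m1⟩ := forth C h hp x
    obtain ⟨C2, k2, q2, s2, a2, m2⟩ := back C1 k1 q1 x
    refine ⟨⟨⟨C2, k2⟩, q2⟩, s1.trans s2, ?_, s2 m1, m2⟩
    intro c hc
    exact (a2 c (s1 hc)).trans (a1 c hc)
  choose nx n1 n2 n3 n4 using both
  let q : ℕ → {p : Finset ℕ × Equiv.Perm ℕ // Q p.1 p.2} :=
    fun n => Nat.rec ⟨⟨C0, h0⟩, hQ⟩ (fun n p => nx p n) n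
  have q0 : q 0 = ⟨⟨C0, h0⟩, hQ⟩ := rfl
  have qs : ∀ n, q (n+1) = nx (q n) n := fun n => rfl
  have step1 : ∀ n, (q n).1.1 ⊆ (q (n+1)).1.1 := fun n => by rw [qs]; exact n1 _ _
  have step2 : ∀ n, ∀ c ∈ (q n).1.1, (q (n+1)).1.2 c = (q n).1.2 c := fun n => by
    rw [qs]; exact n2 _ _
  have step3 : ∀ n, n ∈ (q (n+1)).1.1 := fun n => by rw [qs]; exact n3 _ _
  have step4 : ∀ n, ∃ c ∈ (q (n+1)).1.1, (q (n+1)).1.2 c = n := fun n => by rw [qs]; exact n4 _ _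
  have mono : Monotone (fun n => (q n).1.1) := monotone_nat_of_le_succ step1
  have agree : ∀ m n, m ≤ n → ∀ c ∈ (q m).1.1, (q n).1.2 c = (q m).1.2 c := by
    intro m n hmn c hc
    induction n, hmn using Nat.le_induction with
    | base => rfl
    | succ n hn ih => rw [step2 n c (mono hn hc), ih]
  obtain ⟨k, hk⟩ := seqlim (fun n => (q (n+1)).1.2) (fun n x hx => by
      exact step2 (n+1) x (mono (Nat.succ_le_succ hx) (step3 x))) (fun n x hx => by
      obtain ⟨c, hc, hcx⟩ := step4 x
      have e1 : (q (n+1)).1.2 c = x := by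
        rw [agree (x+1) (n+1) (by omega) c hc, hcx]
      have e2 : (q (n+1+1)).1.2 c = x := by
        rw [agree (x+1) (n+1+1) (by omega) c hc, hcx]
      show (q (n+1+1)).1.2.symm x = (q (n+1)).1.2.symm x
      rw [(Equiv.symm_apply_eq _).2 e1.symm, (Equiv.symm_apply_eq _).2 e2.symm])
  have kq : ∀ m, ∀ c ∈ (q m).1.1, k c = (q m).1.2 c := by
    intro m c hc
    rw [hk c (max c m) (le_max_left _ _)]
    exact agree m (max c m + 1) (by have := le_max_right c m; omega) c hc
  refine ⟨k, fun c hc => kq 0 c hc, fun F => ?_⟩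
  refine ⟨(q (F.sup id + 1)).1.1, (q (F.sup id + 1)).1.2, ?_, (q (F.sup id + 1)).2,
    kq (F.sup id + 1)⟩
  intro x hx
  have : x ≤ F.sup id := Finset.le_sup (f := id) hx
  exact mono (Nat.succ_le_succ this) (step3 x)

theorem ext_perm (C : Finset ℕ) (h : ℕ → ℕ) (hi : Set.InjOn h C) :
    ∃ k : Equiv.Perm ℕ, ∀ c ∈ C, k c = h c := by
  induction C using Finset.induction_on with
  | empty => exact ⟨1, by simp⟩
  | insert t C ht ih =>
    obtain ⟨k, hk⟩ := ih (hi.mono (by simp))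
    refine ⟨Equiv.swap (k t) (h t) * k, fun c hc => ?_⟩
    rw [Equiv.Perm.mul_apply]
    rcases Finset.mem_insert.1 hc with rfl | hc'
    · simp
    · have hct : c ≠ t := by rintro rfl; exact ht hc'
      rw [Equiv.swap_apply_of_ne_of_ne, hk c hc']
      · exact fun h1 => hct (k.injective h1)
      · rw [hk c hc']
        exact fun h1 => hct (hi (by simp [hc']) (by simp) h1)

theorem hom {G : SimpleGraph ℕ} (hG : G.ExtensionProperty) (C : Finset ℕ) (h : ℕ → ℕ)
    (hh : PEmb G G C h) : ∃ k : G ≃g G, ∀ c ∈ C, k c = h c := by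
  obtain ⟨h0, hh0⟩ := ext_perm C h (fun x hx y hy => (hh x hx y hy).1)
  have base : PEmb G G C h0 := by
    intro x hx y hy
    rw [hh0 x hx, hh0 y hy]
    exact hh x hx y hy
  have key : ∀ (C : Finset ℕ) (h : Equiv.Perm ℕ) (x y : ℕ), PEmb G G C h → x ∉ C → y ∉ C.image h →
      (∀ z ∈ C, (G.Adj y (h z) ↔ G.Adj x z)) →
      ∃ h' : Equiv.Perm ℕ, PEmb G G (insert x C) h' ∧ (∀ c ∈ C, h' c = h c) ∧ h' x = y := by
    intro C h x y hp hx hy hadj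
    have e1 : (Equiv.swap (h x) y * h) x = y := by simp
    have e2 : ∀ c ∈ C, (Equiv.swap (h x) y * h) c = h c := by
      intro c hc
      rw [Equiv.Perm.mul_apply, Equiv.swap_apply_of_ne_of_ne]
      · intro h1
        exact hx (h.injective h1 ▸ hc)
      · intro h1
        exact hy (Finset.mem_image.2 ⟨c, hc, h1⟩)
    refine ⟨Equiv.swap (h x) y * h, ?_, e2, e1⟩
    refine pemb_insert hp e2 (by rwa [e1]) (by rwa [e1])
  obtain ⟨k, hk1, hk2⟩ := lim (fun C h => PEmb G G C h) (by
      intro C h hp x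
      by_cases hx : x ∈ C
      · exact ⟨C, h, hp, subset_rfl, fun _ _ => rfl, hx⟩
      · obtain ⟨v, hv, hadj⟩ := emb_one hG G C h hp x
        obtain ⟨h', a, b, c⟩ := key C h x v hp hx hv hadj
        exact ⟨_, h', a, by simp, b, by simp⟩) (by
      intro C h hp y
      by_cases hy : y ∈ C.image h
      · exact ⟨C, h, hp, subset_rfl, fun _ _ => rfl, by simpa using hy⟩
      · have hp' : PEmb G G (C.image h) h.symm := by
          intro a ha b hb
          obtain ⟨a, ha', rfl⟩ := Finset.mem_image.1 ha
          obtain ⟨b, hb', rfl⟩ := Finset.mem_image.1 hb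
          simp [(hp a ha' b hb').2]
        obtain ⟨v, hv, hadj⟩ := emb_one hG G (C.image h) h.symm hp' y
        have hv' : v ∉ C := by
          intro hvC
          exact hv (Finset.mem_image.2 ⟨h v, Finset.mem_image_of_mem _ hvC, by simp⟩)
        obtain ⟨h', a, b, c⟩ := key C h v y hp hv' hy (fun z hz => by
          have := hadj (h z) (Finset.mem_image_of_mem _ hz)
          rw [Equiv.symm_apply_apply] at this
          exact this.symm)
        exact ⟨_, h', a, by simp, b, v, by simp, c⟩) C h0 base
  refine ⟨⟨k, ?_⟩, fun c hc => (hk1 c hc).trans (hh0 c hc)⟩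
  intro a b
  obtain ⟨D, h', hD, hQ, hag⟩ := hk2 {a, b}
  have ha : a ∈ D := hD (by simp)
  have hb : b ∈ D := hD (by simp)
  rw [hag a ha, hag b hb]
  exact (hQ a ha b hb).2

end SIP

end

section

namespace SIP

/-- The graph used for extending partial automorphisms of a finite graph. -/
def eppaGraph (V : Type) : SimpleGraph (V × (V → Bool)) where
  Adj a b := a.1 ≠ b.1 ∧ a.2 b.1 ≠ b.2 a.1
  symm := ⟨fun _ _ h => ⟨h.1.symm, h.2.symm⟩⟩
  loopless := ⟨fun _ h => h.1 rfl⟩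

theorem eppa {G : SimpleGraph ℕ} (hG : G.ExtensionProperty) (C : Finset ℕ) :
    ∃ B : Finset ℕ, C ⊆ B ∧ ∀ g : G ≃g G, ∃ g' : G ≃g G, (∀ b ∈ B, g' b ∈ B) ∧
      ∀ x ∈ C, g x ∈ C → g' x = g x := by
  classical
  let e0 : C → C × (C → Bool) := fun x => (x, fun y => decide (y < x ∧ G.Adj x y))
  have adj0 : ∀ x y : C, x ≠ y → (xor ((e0 x).2 y) ((e0 y).2 x)) = decide (G.Adj x y) := by
    intro x y hxy
    have := G.adj_comm (x : ℕ) y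
    rcases lt_or_gt_of_ne hxy with h | h
    · simp [e0, h, h.not_gt, this]
    · simp [e0, h, h.not_gt]
  obtain ⟨e, he1, he2⟩ := emb hG (eppaGraph C) (Finset.univ.image e0) Finset.univ
    (fun b => (b.1 : ℕ)) (by
      intro a ha b hb
      obtain ⟨x, -, rfl⟩ := Finset.mem_image.1 ha
      obtain ⟨y, -, rfl⟩ := Finset.mem_image.1 hb
      refine ⟨fun h => ?_, ?_⟩
      · have : x = y := Subtype.ext h
        rw [this]
      · show G.Adj x y ↔ (x ≠ y ∧ (e0 x).2 y ≠ (e0 y).2 x)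
        by_cases hxy : x = y
        · simp [hxy]
        · have := adj0 x y hxy
          by_cases hadj : G.Adj x y <;> simp [hadj] at this <;> simp [hadj, hxy, this])
  have he3 : ∀ a b, (e a = e b → a = b) ∧ (G.Adj (e a) (e b) ↔ (eppaGraph C).Adj a b) :=
    fun a b => he2 a (by simp) b (by simp)
  have einj : Function.Injective e := fun a b h => (he3 a b).1 h
  have ee0 : ∀ x : C, e (e0 x) = x := fun x => he1 (e0 x) (by simp)
  refine ⟨Finset.univ.image e, ?_, fun g => ?_⟩
  · intro x hx
    exact Finset.mem_image.2 ⟨e0 ⟨x, hx⟩, by simp, ee0 ⟨x, hx⟩⟩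
  let p : C → Prop := fun x => g x ∈ C
  let q : C → Prop := fun x => g.symm x ∈ C
  let E : {x // p x} ≃ {x // q x} :=
    { toFun := fun x => ⟨⟨g x.1, x.2⟩, by simp [q]⟩
      invFun := fun x => ⟨⟨g.symm x.1, x.2⟩, by simp [p]⟩
      left_inv := fun x => by simp
      right_inv := fun x => by simp }
  let π : Equiv.Perm C := E.extendSubtype
  have hπ : ∀ x : C, p x → ((π x : C) : ℕ) = g x := by
    intro x hx
    have := E.extendSubtype_apply_of_mem x hx
    show ((E.extendSubtype x : C) : ℕ) = g x
    rw [this]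
    rfl
  let fl : C → C → Bool := fun x y =>
    if p x then xor ((e0 x).2 y) ((e0 (π x)).2 (π y))
    else if p y then xor ((e0 y).2 x) ((e0 (π y)).2 (π x)) else false
  have flp : ∀ x y, p x → fl x y = xor ((e0 x).2 y) ((e0 (π x)).2 (π y)) := by
    intro x y hx
    simp only [fl, if_pos hx]
  have flsymm : ∀ x y, x ≠ y → fl x y = fl y x := by
    intro x y hxy
    by_cases hx : p x <;> by_cases hy : p y
    · rw [flp x y hx, flp y x hy]
      have h1 := adj0 x y hxy
      have h2 := adj0 (π x) (π y) (fun h => hxy (π.injective h))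
      rw [hπ x hx, hπ y hy] at h2
      have h3 : G.Adj (g x) (g y) ↔ G.Adj x y := g.map_adj_iff
      simp only [h3] at h2
      rw [← h1] at h2
      revert h2
      generalize (e0 x).2 y = a
      generalize (e0 y).2 x = b
      generalize (e0 (π x)).2 (π y) = c
      generalize (e0 (π y)).2 (π x) = d
      revert a b c d
      decide
    · simp only [fl, if_pos hx, if_neg hy]
    · simp only [fl, if_pos hy, if_neg hx]
    · simp only [fl, if_neg hx, if_neg hy]
  let θ : C × (C → Bool) → C × (C → Bool) := fun a =>
    (π a.1, fun z => xor (a.2 (π.symm z)) (fl a.1 (π.symm z)))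
  have θe0 : ∀ x, p x → θ (e0 x) = e0 (π x) := by
    intro x hx
    refine Prod.ext rfl ?_
    funext z
    show xor ((e0 x).2 (π.symm z)) (fl x (π.symm z)) = (e0 (π x)).2 z
    rw [flp x _ hx]
    simp
  have θinj : Function.Injective θ := by
    rintro ⟨x, χ⟩ ⟨y, ψ⟩ h
    have h1 : x = y := π.injective (congrArg Prod.fst h)
    subst h1
    have h2 := congrArg Prod.snd h
    refine Prod.ext rfl ?_
    funext z
    have h3 := congrFun h2 (π z)
    simpa [θ] using h3
  have θadj : ∀ a b, (eppaGraph C).Adj (θ a) (θ b) ↔ (eppaGraph C).Adj a b := by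
    rintro ⟨x, χ⟩ ⟨y, ψ⟩
    show (π x ≠ π y ∧ xor (χ (π.symm (π y))) (fl x (π.symm (π y))) ≠
      xor (ψ (π.symm (π x))) (fl y (π.symm (π x)))) ↔ (x ≠ y ∧ χ y ≠ ψ x)
    by_cases hxy : x = y
    · simp [hxy]
    · simp [hxy, flsymm x y hxy]
  obtain ⟨g', hg'⟩ := hom hG (Finset.univ.image e) (Function.extend e (fun a => e (θ a)) id) (by
    intro a ha b hb
    obtain ⟨a, -, rfl⟩ := Finset.mem_image.1 ha
    obtain ⟨b, -, rfl⟩ := Finset.mem_image.1 hb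
    simp only [einj.extend_apply]
    refine ⟨fun h => ?_, ?_⟩
    · rw [θinj (einj h)]
    · rw [(he3 _ _).2, (he3 _ _).2, θadj])
  have hg2 : ∀ a, g' (e a) = e (θ a) := by
    intro a
    rw [hg' _ (Finset.mem_image_of_mem e (Finset.mem_univ a))]
    simp only [einj.extend_apply]
  refine ⟨g', ?_, ?_⟩
  · intro b hb
    obtain ⟨b, -, rfl⟩ := Finset.mem_image.1 hb
    rw [hg2]
    exact Finset.mem_image_of_mem e (Finset.mem_univ _)
  · intro x hx hgx
    have h1 := hg2 (e0 ⟨x, hx⟩)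
    rw [θe0 _ hgx, ee0, ee0, hπ _ hgx] at h1
    exact h1

theorem inv_not_mem {G : SimpleGraph ℕ} {C : Finset ℕ} {a : G ≃g G} (ha : ∀ c ∈ C, a c ∈ C)
    {x : ℕ} (hx : x ∉ C) : a x ∉ C := by
  intro h
  have h1 : C.image a = C := Finset.eq_of_subset_of_card_le
    (fun y hy => by
      obtain ⟨c, hc, rfl⟩ := Finset.mem_image.1 hy
      exact ha c hc)
    (by rw [Finset.card_image_of_injective _ a.injective])
  rw [← h1] at h
  obtain ⟨c, hc, hcx⟩ := Finset.mem_image.1 h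
  exact hx (a.injective hcx ▸ hc)

theorem union_aut {G : SimpleGraph ℕ} (hG : G.ExtensionProperty) (C D E : Finset ℕ)
    (hCE : C ⊆ E) (hDE : ∀ x ∈ D, x ∈ E → x ∈ C)
    (hfree : ∀ x ∈ D, ∀ y ∈ E, x ∉ C → y ∉ C → ¬ G.Adj x y)
    (a b : G ≃g G) (haD : ∀ x ∈ D, a x ∈ D) (hbE : ∀ x ∈ E, b x ∈ E)
    (haC : ∀ x ∈ C, a x ∈ C) (hab : ∀ x ∈ C, a x = b x) :
    ∃ k : G ≃g G, (∀ x ∈ D, k x = a x) ∧ ∀ x ∈ E, k x = b x := by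
  classical
  have hbC : ∀ x ∈ C, b x ∈ C := fun x hx => hab x hx ▸ haC x hx
  let u : ℕ → ℕ := fun x => if x ∈ E then b x else a x
  have uE : ∀ x ∈ E, u x = b x := fun x hx => by simp only [u, if_pos hx]
  have uD : ∀ x ∈ D, u x = a x := fun x hx => by
    by_cases hE : x ∈ E
    · rw [uE x hE, hab x (hDE x hx hE)]
    · simp only [u, if_neg hE]
  have mixed : ∀ x ∈ D, ∀ y ∈ E, x ∉ C → y ∉ C →
      (u x ≠ u y) ∧ ¬ G.Adj (u x) (u y) ∧ ¬ G.Adj x y := by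
    intro x hx y hy hxC hyC
    rw [uD x hx, uE y hy]
    refine ⟨fun h => ?_, hfree _ (haD x hx) _ (hbE y hy) (inv_not_mem haC hxC) (inv_not_mem hbC hyC),
      hfree x hx y hy hxC hyC⟩
    exact inv_not_mem haC hxC (hDE _ (haD x hx) (h ▸ hbE y hy))
  obtain ⟨k, hk⟩ := hom hG (D ∪ E) u (by
    intro x hx y hy
    by_cases hxE : x ∈ E <;> by_cases hyE : y ∈ E
    · rw [uE x hxE, uE y hyE]
      exact ⟨fun h => b.injective h, b.map_adj_iff⟩
    · have hyD : y ∈ D := by simpa [hyE] using hy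
      have hyC : y ∉ C := fun h => hyE (hCE h)
      by_cases hxD : x ∈ D
      · rw [uD x hxD, uD y hyD]
        exact ⟨fun h => a.injective h, a.map_adj_iff⟩
      · by_cases hxC : x ∈ C
        · rw [uE x hxE, ← hab x hxC, uD y hyD]
          exact ⟨fun h => a.injective h, a.map_adj_iff⟩
        · obtain ⟨h1, h2, h3⟩ := mixed y hyD x hxE hyC hxC
          refine ⟨fun h => absurd h.symm h1, ?_⟩
          rw [G.adj_comm, G.adj_comm x y]
          simp [h2, h3]
    · have hxD : x ∈ D := by simpa [hxE] using hx
      have hxC : x ∉ C := fun h => hxE (hCE h)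
      by_cases hyD : y ∈ D
      · rw [uD x hxD, uD y hyD]
        exact ⟨fun h => a.injective h, a.map_adj_iff⟩
      · by_cases hyC : y ∈ C
        · rw [uE y hyE, ← hab y hyC, uD x hxD]
          exact ⟨fun h => a.injective h, a.map_adj_iff⟩
        · obtain ⟨h1, h2, h3⟩ := mixed x hxD y hyE hxC hyC
          refine ⟨fun h => absurd h h1, ?_⟩
          simp [h2, h3]
    · have hxD : x ∈ D := by simpa [hxE] using hx
      have hyD : y ∈ D := by simpa [hyE] using hy
      rw [uD x hxD, uD y hyD]
      exact ⟨fun h => a.injective h, a.map_adj_iff⟩)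
  refine ⟨k, fun x hx => ?_, fun x hx => ?_⟩
  · rw [hk x (Finset.mem_union_left _ hx), uD x hx]
  · rw [hk x (Finset.mem_union_right _ hx), uE x hx]

/-- The free amalgam of two copies of `G` over `C`. -/
def freeGraph (G : SimpleGraph ℕ) (C : Finset ℕ) : SimpleGraph (ℕ ⊕ ℕ) where
  Adj
    | .inl x, .inl y => G.Adj x y
    | .inr x, .inr y => G.Adj x y
    | .inl x, .inr y => x ∈ C ∧ G.Adj x y
    | .inr x, .inl y => y ∈ C ∧ G.Adj y x
  symm := ⟨by
    rintro (x | x) (y | y) h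
    · exact G.symm.symm _ _ h
    · exact h
    · exact h
    · exact G.symm.symm _ _ h⟩
  loopless := ⟨by
    rintro (x | x) h
    · exact G.loopless.irrefl x h
    · exact G.loopless.irrefl x h⟩

theorem free_amalgam {G : SimpleGraph ℕ} (hG : G.ExtensionProperty) (C B D : Finset ℕ)
    (hCB : C ⊆ B) (hCD : C ⊆ D) :
    ∃ ψ : G ≃g G, (∀ c ∈ C, ψ c = c) ∧ (∀ b ∈ B, b ∉ C → ψ b ∉ D) ∧
      ∀ b ∈ B, b ∉ C → ∀ d ∈ D, d ∉ C → ¬ G.Adj d (ψ b) := by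
  classical
  obtain ⟨e, he1, he2⟩ := emb hG (freeGraph G C) (D.image Sum.inl) ((B \ C).image Sum.inr)
    (Sum.elim id id) (by
      intro a ha b hb
      obtain ⟨x, -, rfl⟩ := Finset.mem_image.1 ha
      obtain ⟨y, -, rfl⟩ := Finset.mem_image.1 hb
      refine ⟨fun h => by simpa using h, ?_⟩
      exact Iff.rfl)
  have heD : ∀ d ∈ D, e (.inl d) = d := fun d hd => he1 _ (by simpa using hd)
  have mD : ∀ d ∈ D, (Sum.inl d : ℕ ⊕ ℕ) ∈ (B \ C).image Sum.inr ∪ D.image Sum.inl := by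
    intro d hd; simpa using hd
  have mB : ∀ b ∈ B, b ∉ C → (Sum.inr b : ℕ ⊕ ℕ) ∈ (B \ C).image Sum.inr ∪ D.image Sum.inl := by
    intro b hb hb'; simp [hb, hb']
  let u : ℕ → ℕ := fun x => if x ∈ C then x else e (.inr x)
  have uC : ∀ x ∈ C, u x = x := fun x hx => by simp only [u, if_pos hx]
  have uB : ∀ x, x ∉ C → u x = e (.inr x) := fun x hx => by simp only [u, if_neg hx]
  have key : ∀ b ∈ B, b ∉ C → ∀ d ∈ D, d ≠ u b ∧ (G.Adj d (u b) ↔ (d ∈ C ∧ G.Adj d b)) := by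
    intro b hb hbC d hd
    have := he2 _ (mD d hd) _ (mB b hb hbC)
    rw [heD d hd, ← uB b hbC] at this
    exact ⟨fun h => by simpa using this.1 h, this.2⟩
  obtain ⟨ψ, hψ⟩ := hom hG B u (by
    intro x hx y hy
    by_cases hxC : x ∈ C <;> by_cases hyC : y ∈ C
    · rw [uC x hxC, uC y hyC]; simp
    · obtain ⟨k1, k2⟩ := key y hy hyC x (hCD hxC)
      rw [uC x hxC, k2]
      exact ⟨fun h => absurd h k1, by simp [hxC]⟩
    · obtain ⟨k1, k2⟩ := key x hx hxC y (hCD hyC)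
      rw [uC y hyC, G.adj_comm, k2, G.adj_comm x y]
      exact ⟨fun h => absurd h.symm k1, by simp [hyC]⟩
    · have := he2 _ (mB x hx hxC) _ (mB y hy hyC)
      rw [uB x hxC, uB y hyC]
      exact ⟨fun h => by simpa using this.1 h, this.2⟩)
  refine ⟨ψ, fun c hc => ?_, fun b hb hbC h => ?_, fun b hb hbC d hd hdC h => ?_⟩
  · rw [hψ c (hCB hc), uC c hc]
  · rw [hψ b hb] at h
    exact (key b hb hbC _ h).1 rfl
  · rw [hψ b hb] at h
    exact hdC ((key b hb hbC d hd).2.1 h).1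

end SIP

end

section

namespace SIP

/-- `C` is invariant under the first `n` members of the sequence `f`. -/
def Inv {G : SimpleGraph ℕ} (n : ℕ) (f : ℕ → (G ≃g G)) (C : Finset ℕ) : Prop :=
  ∀ i < n, ∀ c ∈ C, f i c ∈ C

/-- The tuple `f 0, ..., f (n-1)` is generic. -/
structure Good {G : SimpleGraph ℕ} (n : ℕ) (f : ℕ → (G ≃g G)) : Prop where
  lf : ∀ F : Finset ℕ, ∃ C : Finset ℕ, F ⊆ C ∧ Inv n f C
  ext : ∀ (C B : Finset ℕ) (g : ℕ → (G ≃g G)), C ⊆ B → Inv n f C → Inv n g B →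
    (∀ i < n, ∀ c ∈ C, g i c = f i c) →
    ∃ φ : G ≃g G, (∀ c ∈ C, φ c = c) ∧ ∀ i < n, ∀ b ∈ B, φ (g i b) = f i (φ b)

theorem good_zero {G : SimpleGraph ℕ} (f : ℕ → (G ≃g G)) : Good 0 f where
  lf F := ⟨F, subset_rfl, fun i hi => absurd hi (Nat.not_lt_zero i)⟩
  ext _ _ _ _ _ _ _ := ⟨1, fun _ _ => rfl, fun i hi => absurd hi (Nat.not_lt_zero i)⟩

variable {G : SimpleGraph ℕ}

theorem forth {n : ℕ} {f f' : ℕ → (G ≃g G)} (hf : Good n f) (hf' : Good n f')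
    (C : Finset ℕ) (hC : Inv n f C) (h0 : G ≃g G)
    (hh : ∀ i < n, ∀ c ∈ C, h0 (f i c) = f' i (h0 c)) (x : ℕ) :
    ∃ (C' : Finset ℕ) (h1 : G ≃g G), C ⊆ C' ∧ x ∈ C' ∧ Inv n f C' ∧ (∀ c ∈ C, h1 c = h0 c) ∧
      ∀ i < n, ∀ c ∈ C', h1 (f i c) = f' i (h1 c) := by
  classical
  obtain ⟨C', hCC', hC'⟩ := hf.lf (insert x C)
  have hs : C ⊆ C' := (Finset.subset_insert x C).trans hCC'
  obtain ⟨φ, h1, h2⟩ := hf'.ext (C.image h0) (C'.image h0) (fun i => h0 * f i * h0⁻¹)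
    (Finset.image_subset_image hs) (by
      intro i hi c hc
      obtain ⟨c, hc', rfl⟩ := Finset.mem_image.1 hc
      replace hc := hc'
      rw [← hh i hi c hc]
      exact Finset.mem_image_of_mem _ (hC i hi c hc)) (by
      intro i hi c hc
      obtain ⟨c, hc', rfl⟩ := Finset.mem_image.1 hc
      replace hc := hc'
      simp only [RelIso.mul_apply, RelIso.inv_apply_self]
      exact Finset.mem_image_of_mem _ (hC' i hi c hc)) (by
      intro i hi c hc
      obtain ⟨c, hc', rfl⟩ := Finset.mem_image.1 hc
      replace hc := hc'
      simp only [RelIso.mul_apply, RelIso.inv_apply_self]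
      exact hh i hi c hc)
  refine ⟨C', φ * h0, hs, hCC' (by simp), hC', fun c hc => ?_, fun i hi c hc => ?_⟩
  · exact h1 _ (Finset.mem_image_of_mem _ hc)
  · have := h2 i hi (h0 c) (Finset.mem_image_of_mem _ hc)
    simp only [RelIso.mul_apply, RelIso.inv_apply_self] at this ⊢
    exact this

theorem conj_good {n : ℕ} {f f' : ℕ → (G ≃g G)} (hf : Good n f) (hf' : Good n f')
    (C : Finset ℕ) (hC : Inv n f C) (h0 : G ≃g G)
    (hh : ∀ i < n, ∀ c ∈ C, h0 (f i c) = f' i (h0 c)) :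
    ∃ k : G ≃g G, (∀ c ∈ C, k c = h0 c) ∧ ∀ i < n, ∀ x, k (f i x) = f' i (k x) := by
  classical
  obtain ⟨k, hk1, hk2⟩ := lim (fun C h => Inv n f C ∧ ∃ h0 : G ≃g G, h = h0.toEquiv ∧
      ∀ i < n, ∀ c ∈ C, h0 (f i c) = f' i (h0 c)) (by
    rintro C h ⟨hC, h0, rfl, hh⟩ x
    obtain ⟨C', h1, a1, a2, a3, a4, a5⟩ := forth hf hf' C hC h0 hh x
    exact ⟨C', h1.toEquiv, ⟨a3, h1, rfl, a5⟩, a1, a4, a2⟩) (by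
    rintro C h ⟨hC, h0, rfl, hh⟩ y
    have hC1 : Inv n f' (C.image h0) := by
      intro i hi c hc
      obtain ⟨c, hc', rfl⟩ := Finset.mem_image.1 hc
      replace hc := hc'
      rw [← hh i hi c hc]
      exact Finset.mem_image_of_mem _ (hC i hi c hc)
    obtain ⟨C', h1, a1, a2, a3, a4, a5⟩ := forth hf' hf (C.image h0) hC1 h0⁻¹ (by
      intro i hi c hc
      obtain ⟨c, hc', rfl⟩ := Finset.mem_image.1 hc
      replace hc := hc'
      rw [← hh i hi c hc]
      simp only [RelIso.inv_apply_self]) y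
    have a4' : ∀ c ∈ C, h1 (h0 c) = c := by
      intro c hc
      rw [a4 _ (Finset.mem_image_of_mem _ hc), RelIso.inv_apply_self]
    refine ⟨C'.image h1, (h1⁻¹).toEquiv, ⟨?_, h1⁻¹, rfl, ?_⟩, ?_, ?_, h1 y,
      Finset.mem_image_of_mem _ a2, RelIso.inv_apply_self h1 y⟩
    · intro i hi c hc
      obtain ⟨c, hc', rfl⟩ := Finset.mem_image.1 hc
      replace hc := hc'
      rw [← a5 i hi c hc]
      exact Finset.mem_image_of_mem _ (a3 i hi c hc)
    · intro i hi c hc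
      obtain ⟨c, hc', rfl⟩ := Finset.mem_image.1 hc
      replace hc := hc'
      rw [← a5 i hi c hc, RelIso.inv_apply_self, RelIso.inv_apply_self]
    · intro c hc
      exact Finset.mem_image.2 ⟨h0 c, a1 (Finset.mem_image_of_mem _ hc), a4' c hc⟩
    · intro c hc
      show h1⁻¹ c = h0 c
      conv_lhs => rw [← a4' c hc]
      exact RelIso.inv_apply_self h1 _) C h0.toEquiv ⟨hC, h0, rfl, hh⟩
  refine ⟨⟨k, ?_⟩, hk1, ?_⟩
  · intro a b
    obtain ⟨D, h', hD, ⟨-, h1, rfl, -⟩, hag⟩ := hk2 {a, b}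
    have ha : a ∈ D := hD (by simp)
    have hb : b ∈ D := hD (by simp)
    rw [hag a ha, hag b hb]
    exact h1.map_rel_iff
  · intro i hi x
    obtain ⟨D, h', hD, ⟨hinv, h1, rfl, hq⟩, hag⟩ := hk2 {x}
    have hx : x ∈ D := hD (by simp)
    show k (f i x) = f' i (k x)
    rw [hag x hx, hag _ (hinv i hi x hx)]
    exact hq i hi x hx

theorem lf_dense (hG : G.ExtensionProperty) {n : ℕ} {f : ℕ → (G ≃g G)} (hf : Good n f)
    (x : G ≃g G) (F : Finset ℕ) :
    ∃ (x' : G ≃g G) (D : Finset ℕ), (∀ c ∈ F, x' c = x c) ∧ F ⊆ D ∧ Inv n f D ∧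
      ∀ d ∈ D, x' d ∈ D := by
  classical
  obtain ⟨C, hC, hCinv⟩ := hf.lf (F ∪ F.image x)
  obtain ⟨B, hCB, hB⟩ := eppa hG C
  choose e he1 he2 using hB
  obtain ⟨φ, h1, h2⟩ := hf.ext C B (fun i => e (f i)) hCB hCinv (fun i _ => he1 (f i))
    (fun i hi c hc => he2 (f i) c hc (hCinv i hi c hc))
  have hF : ∀ c ∈ F, c ∈ C := fun c hc => hC (Finset.mem_union_left _ hc)
  have hF' : ∀ c ∈ F, x c ∈ C := fun c hc =>
    hC (Finset.mem_union_right _ (Finset.mem_image_of_mem _ hc))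
  refine ⟨φ * e x * φ⁻¹, B.image φ, ?_, ?_, ?_, ?_⟩
  · intro c hc
    have : φ⁻¹ c = c := by
      conv_lhs => rw [← h1 c (hF c hc)]
      exact RelIso.inv_apply_self _ _
    rw [RelIso.mul_apply, RelIso.mul_apply, this, he2 x c (hF c hc) (hF' c hc), h1 _ (hF' c hc)]
  · intro c hc
    exact Finset.mem_image.2 ⟨c, hCB (hF c hc), h1 c (hF c hc)⟩
  · intro i hi c hc
    obtain ⟨c, hc', rfl⟩ := Finset.mem_image.1 hc
    replace hc := hc'
    rw [← h2 i hi c hc]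
    exact Finset.mem_image_of_mem _ (he1 _ c hc)
  · intro c hc
    obtain ⟨c, hc', rfl⟩ := Finset.mem_image.1 hc
    replace hc := hc'
    simp only [RelIso.mul_apply, RelIso.inv_apply_self]
    exact Finset.mem_image_of_mem _ (he1 _ c hc)

theorem ext_dense (hG : G.ExtensionProperty) {n : ℕ} {f : ℕ → (G ≃g G)} (hf : Good n f)
    (x : G ≃g G) (F C B : Finset ℕ) (g : ℕ → (G ≃g G)) (hCB : C ⊆ B) (hC : Inv n f C)
    (hB : Inv (n+1) g B) (hgf : ∀ i < n, ∀ c ∈ C, g i c = f i c)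
    (hCn : ∀ c ∈ C, g n c ∈ C) (hx : ∀ c ∈ C, x c = g n c) :
    ∃ x' φ : G ≃g G, (∀ c ∈ F, x' c = x c) ∧ (∀ c ∈ C, φ c = c) ∧
      (∀ i < n, ∀ b ∈ B, φ (g i b) = f i (φ b)) ∧ ∀ b ∈ B, φ (g n b) = x' (φ b) := by
  classical
  obtain ⟨x1, D, hx1, hFD, hD, hDx⟩ := lf_dense hG hf x (F ∪ C)
  have hCD : C ⊆ D := Finset.subset_union_right.trans hFD
  have hx1C : ∀ c ∈ C, x1 c = g n c := fun c hc => by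
    rw [hx1 c (Finset.mem_union_right _ hc), hx c hc]
  obtain ⟨ψ, ψ1, ψ2, ψ3⟩ := free_amalgam hG C B D hCB hCD
  have ψi : ∀ c ∈ C, ψ⁻¹ c = c := by
    intro c hc
    conv_lhs => rw [← ψ1 c hc]
    exact RelIso.inv_apply_self _ _
  -- gluing of automorphisms
  have glue : ∀ a b : G ≃g G, (∀ d ∈ D, a d ∈ D) → (∀ y ∈ B, b y ∈ B) → (∀ c ∈ C, a c ∈ C) →
      (∀ c ∈ C, a c = b c) → ∃ k : G ≃g G, (∀ d ∈ D, k d = a d) ∧ ∀ y ∈ B, k (ψ y) = ψ (b y) := by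
    intro a b haD hbB haC hab
    obtain ⟨k, k1, k2⟩ := union_aut hG C D (B.image ψ) (by
        intro c hc
        exact Finset.mem_image.2 ⟨c, hCB hc, ψ1 c hc⟩) (by
        intro d hd hd'
        obtain ⟨b, hb, rfl⟩ := Finset.mem_image.1 hd'
        by_contra hne
        by_cases hbC : b ∈ C
        · exact hne (by rwa [ψ1 b hbC])
        · exact ψ2 b hb hbC hd) (by
        intro d hd y hy hdC hyC
        obtain ⟨b, hb, rfl⟩ := Finset.mem_image.1 hy
        by_cases hbC : b ∈ C
        · exact absurd (by rwa [ψ1 b hbC]) hyC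
        · exact ψ3 b hb hbC d hd hdC) a (ψ * b * ψ⁻¹) haD (by
        intro y hy
        obtain ⟨y, hy', rfl⟩ := Finset.mem_image.1 hy
        replace hy := hy'
        simp only [RelIso.mul_apply, RelIso.inv_apply_self]
        exact Finset.mem_image_of_mem _ (hbB y hy)) haC (by
        intro c hc
        rw [RelIso.mul_apply, RelIso.mul_apply, ψi c hc, ← hab c hc, ψ1 _ (haC c hc)])
    refine ⟨k, k1, fun y hy => ?_⟩
    rw [k2 _ (Finset.mem_image_of_mem _ hy)]
    simp only [RelIso.mul_apply, RelIso.inv_apply_self]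
  have glue1 : ∀ i, ∃ k : G ≃g G, i < n → (∀ d ∈ D, k d = f i d) ∧ ∀ y ∈ B, k (ψ y) = ψ (g i y) := by
    intro i
    by_cases hi : i < n
    · obtain ⟨k, hk⟩ := glue (f i) (g i) (hD i hi) (hB i (by omega)) (hC i hi)
        (fun c hc => (hgf i hi c hc).symm)
      exact ⟨k, fun _ => hk⟩
    · exact ⟨1, fun h => absurd h hi⟩
  choose g' hg' using glue1
  obtain ⟨k, k1, k2⟩ := glue x1 (g n) hDx (hB n (by omega))
    (fun c hc => by rw [hx1C c hc]; exact hCn c hc) hx1C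
  obtain ⟨φ, φ1, φ2⟩ := hf.ext D (D ∪ B.image ψ) g' Finset.subset_union_left hD (by
    intro i hi c hc
    rcases Finset.mem_union.1 hc with hc | hc
    · rw [(hg' i hi).1 c hc]
      exact Finset.mem_union_left _ (hD i hi c hc)
    · obtain ⟨c, hc', rfl⟩ := Finset.mem_image.1 hc
      replace hc := hc'
      rw [(hg' i hi).2 c hc]
      exact Finset.mem_union_right _ (Finset.mem_image_of_mem _ (hB i (by omega) c hc)))
    (fun i hi c hc => (hg' i hi).1 c hc)
  have φi : ∀ d ∈ D, φ⁻¹ d = d := by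
    intro c hc
    conv_lhs => rw [← φ1 c hc]
    exact RelIso.inv_apply_self _ _
  refine ⟨φ * k * φ⁻¹, φ * ψ, ?_, ?_, ?_, ?_⟩
  · intro c hc
    have hcD : c ∈ D := hFD (Finset.mem_union_left _ hc)
    rw [RelIso.mul_apply, RelIso.mul_apply, φi c hcD, k1 c hcD, φ1 _ (hDx c hcD),
      hx1 c (Finset.mem_union_left _ hc)]
  · intro c hc
    rw [RelIso.mul_apply, ψ1 c hc, φ1 c (hCD hc)]
  · intro i hi b hb
    rw [RelIso.mul_apply, RelIso.mul_apply, ← (hg' i hi).2 b hb,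
      φ2 i hi _ (Finset.mem_union_right _ (Finset.mem_image_of_mem _ hb))]
  · intro b hb
    simp only [RelIso.mul_apply, RelIso.inv_apply_self]
    rw [k2 b hb]

end SIP

end

section

namespace SIP
variable {G : SimpleGraph ℕ}

/-- `T` codes the restriction to a finite set `B` of a tuple extending that of `f` on `C`. -/
def Valid (n : ℕ) (f : ℕ → (G ≃g G)) (C : Finset ℕ) (T : Finset (ℕ × ℕ × ℕ)) : Prop :=
  ∃ (B : Finset ℕ) (g : ℕ → (G ≃g G)), C ⊆ B ∧ Inv n f C ∧ Inv (n+1) g B ∧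
    (∀ i < n, ∀ c ∈ C, g i c = f i c) ∧ (∀ c ∈ C, g n c ∈ C) ∧
    ∀ i b v, (i, b, v) ∈ T ↔ i < n + 1 ∧ b ∈ B ∧ v = g i b

/-- The countably many requirements for a generic extension of the tuple `f`. -/
def Req (n : ℕ) (f : ℕ → (G ≃g G)) :
    Finset ℕ ⊕ (Finset ℕ × Finset (ℕ × ℕ × ℕ)) → Set (G ≃g G)
  | .inl F => {x | ∃ C : Finset ℕ, F ⊆ C ∧ Inv n f C ∧ ∀ c ∈ C, x c ∈ C}
  | .inr (C, T) => {x | Valid n f C T → (∃ t ∈ T, t.1 = n ∧ t.2.1 ∈ C ∧ x t.2.1 ≠ t.2.2) ∨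
      ∃ φ : G ≃g G, (∀ c ∈ C, φ c = c) ∧
        ∀ t ∈ T, φ t.2.2 = (Function.update f n x t.1) (φ t.2.1)}

theorem req_open (n : ℕ) (f : ℕ → (G ≃g G)) (r) (x : G ≃g G) (hx : x ∈ Req n f r) :
    ∃ K : Finset ℕ, ∀ y : G ≃g G, (∀ c ∈ K, y c = x c) → y ∈ Req n f r := by
  classical
  rcases r with F | ⟨C, T⟩
  · obtain ⟨C, h1, h2, h3⟩ := hx
    refine ⟨C, fun y hy => ⟨C, h1, h2, fun c hc => ?_⟩⟩
    rw [hy c hc]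
    exact h3 c hc
  · by_cases hv : Valid n f C T
    · rcases hx hv with ⟨t, ht, h1, h2, h3⟩ | ⟨φ, h1, h2⟩
      · refine ⟨C, fun y hy _ => Or.inl ⟨t, ht, h1, h2, ?_⟩⟩
        rwa [hy _ h2]
      · refine ⟨T.image (fun t => φ t.2.1), fun y hy _ => Or.inr ⟨φ, h1, fun t ht => ?_⟩⟩
        rw [h2 t ht]
        by_cases hn : t.1 = n
        · rw [hn, Function.update_self, Function.update_self, 
            hy _ (Finset.mem_image.2 ⟨t, ht, rfl⟩)]
        · rw [Function.update_of_ne hn, Function.update_of_ne hn]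
    · exact ⟨∅, fun y _ h => absurd h hv⟩

theorem req_dense (hG : G.ExtensionProperty) {n : ℕ} {f : ℕ → (G ≃g G)} (hf : Good n f) (r)
    (x : G ≃g G) (K : Finset ℕ) :
    ∃ y ∈ Req n f r, ∀ c ∈ K, y c = x c := by
  classical
  rcases r with F | ⟨C, T⟩
  · obtain ⟨y, D, h1, h2, h3, h4⟩ := lf_dense hG hf x (K ∪ F)
    exact ⟨y, ⟨D, Finset.subset_union_right.trans h2, h3, h4⟩,
      fun c hc => h1 c (Finset.mem_union_left _ hc)⟩
  · by_cases hv : Valid n f C T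
    · obtain ⟨B, g, h1, h2, h3, h4, h5, h6⟩ := hv
      by_cases hx : ∀ c ∈ C, x c = g n c
      · obtain ⟨y, φ, a1, a2, a3, a4⟩ := ext_dense hG hf x K C B g h1 h2 h3 h4 h5 hx
        refine ⟨y, fun _ => Or.inr ⟨φ, a2, ?_⟩, a1⟩
        rintro ⟨i, b, v⟩ ht
        obtain ⟨hi, hb, rfl⟩ := (h6 i b v).1 ht
        by_cases hn : i = n
        · subst hn
          simp only [Function.update_self]
          exact a4 b hb
        · simp only [Function.update_of_ne hn]
          exact a3 i (by omega) b hb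
      · push Not at hx
        obtain ⟨c, hc, hne⟩ := hx
        exact ⟨x, fun _ => Or.inl ⟨(n, c, g n c), (h6 _ _ _).2 ⟨by omega, h1 hc, rfl⟩, rfl, hc, hne⟩,
          fun _ _ => rfl⟩
    · exact ⟨x, fun h => absurd h hv, fun _ _ => rfl⟩

theorem req_good {n : ℕ} {f : ℕ → (G ≃g G)} (x : G ≃g G) (hx : ∀ r, x ∈ Req n f r) :
    Good (n+1) (Function.update f n x) := by
  classical
  constructor
  · intro F
    obtain ⟨C, h1, h2, h3⟩ := hx (.inl F)
    refine ⟨C, h1, fun i hi c hc => ?_⟩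
    by_cases hn : i = n
    · subst hn
      rw [Function.update_self]
      exact h3 c hc
    · rw [Function.update_of_ne hn]
      exact h2 i (by omega) c hc
  · intro C B g hCB hC hB hg
    have hup : ∀ i < n, Function.update f n x i = f i :=
      fun i hi => Function.update_of_ne (by omega) _ _
    have hgx : ∀ c ∈ C, g n c = x c := fun c hc => by
      have := hg n (by omega) c hc
      rwa [Function.update_self] at this
    let T : Finset (ℕ × ℕ × ℕ) :=
      (Finset.range (n+1) ×ˢ B).image (fun p => (p.1, p.2, g p.1 p.2))
    have hT : ∀ i b v, (i, b, v) ∈ T ↔ i < n + 1 ∧ b ∈ B ∧ v = g i b := by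
      intro i b v
      simp only [T, Finset.mem_image, Finset.mem_product, Finset.mem_range, Prod.exists,
        Prod.mk.injEq]
      constructor
      · rintro ⟨i', b', ⟨h1, h2⟩, rfl, rfl, rfl⟩
        exact ⟨h1, h2, rfl⟩
      · rintro ⟨h1, h2, rfl⟩
        exact ⟨i, b, ⟨h1, h2⟩, rfl, rfl, rfl⟩
    have hv : Valid n f C T := by
      refine ⟨B, g, hCB, ?_, hB, ?_, ?_, hT⟩
      · intro i hi c hc
        have := hC i (by omega) c hc
        rwa [hup i hi] at this
      · intro i hi c hc
        rw [hg i (by omega) c hc, hup i hi]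
      · intro c hc
        rw [hg n (by omega) c hc]
        exact hC n (by omega) c hc
    rcases hx (.inr (C, T)) hv with ⟨⟨i, b, v⟩, ht, h1, h2, h3⟩ | ⟨φ, h1, h2⟩
    · obtain ⟨-, -, rfl⟩ := (hT i b v).1 ht
      simp only at h1 h2 h3
      subst h1
      exact absurd (hgx b h2).symm h3
    · exact ⟨φ, h1, fun i hi b hb => h2 (i, b, g i b) ((hT _ _ _).2 ⟨hi, hb, rfl⟩)⟩

end SIP

end

section

namespace SIP
open Topology Set

theorem finite_generic {X : Type} [MetricSpace X] [CompleteSpace X]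
    {ι : Type} [Fintype ι] (D : Set (X × X)) (ho : IsOpen D) (hd : Dense D)
    (c : ι → X) (ε : ℝ) (hε : 0 < ε) :
    ∃ c' : ι → X, dist c' c < ε ∧ ∀ i j, i ≠ j → (c' i, c' j) ∈ D := by
  classical
  let O : {p : ι × ι // p.1 ≠ p.2} → Set (ι → X) := fun p => {c | (c p.1.1, c p.1.2) ∈ D}
  have Oopen : ∀ p, IsOpen (O p) := by
    intro p
    have hc : Continuous (fun c : ι → X => (c p.1.1, c p.1.2)) := by fun_prop
    exact ho.preimage hc
  have Odense : ∀ p, Dense (O p) := by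
    rintro ⟨⟨i, j⟩, hij⟩
    rw [Metric.dense_iff]
    intro c ε hε
    obtain ⟨⟨a, b⟩, h1, h2⟩ := Metric.dense_iff.1 hd (c i, c j) ε hε
    rw [Metric.mem_ball, Prod.dist_eq, max_lt_iff] at h1
    simp only at h1
    simp only at hij
    refine ⟨Function.update (Function.update c i a) j b, ?_, ?_⟩
    · rw [Metric.mem_ball, dist_pi_lt_iff hε]
      intro k
      by_cases hkj : k = j
      · subst hkj; simpa using h1.2
      · rw [Function.update_of_ne hkj]
        by_cases hki : k = i
        · subst hki; simpa using h1.1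
        · rw [Function.update_of_ne hki]; simpa using hε
    · simpa [O, Function.update_of_ne hij] using h2
  obtain ⟨c', h1, h2⟩ := Metric.dense_iff.1 (dense_iInter_of_isOpen Oopen Odense) c ε hε
  exact ⟨c', h1, fun i j hij => mem_iInter.1 h2 ⟨(i, j), hij⟩⟩

theorem cantor_unif {X : Type} [MetricSpace X] (y : C(ℕ → Bool, X)) (ε : ℝ) (hε : 0 < ε) :
    ∃ m : ℕ, ∀ α β : ℕ → Bool, (∀ i < m, α i = β i) → dist (y α) (y β) < ε := by
  by_contra hcon
  push Not at hcon
  let t : ℕ → Set ((ℕ → Bool) × (ℕ → Bool)) :=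
    fun m => {p | (∀ i < m, p.1 i = p.2 i) ∧ ε ≤ dist (y p.1) (y p.2)}
  have tcl : ∀ m, IsClosed (t m) := by
    intro m
    have e : t m = (⋂ i ∈ Finset.range m, {p : (ℕ → Bool) × (ℕ → Bool) | p.1 i = p.2 i}) ∩
        {p | ε ≤ dist (y p.1) (y p.2)} := by
      ext p; simp [t]
    rw [e]
    refine IsClosed.inter (isClosed_biInter fun i _ => ?_) ?_
    · exact isClosed_eq (by fun_prop) (by fun_prop)
    · exact isClosed_le (by fun_prop) (by fun_prop)
  obtain ⟨p, hp⟩ := IsCompact.nonempty_iInter_of_sequence_nonempty_isCompact_isClosed t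
    (fun m p hp => ⟨fun i hi => hp.1 i (by omega), hp.2⟩)
    (fun m => by obtain ⟨α, β, h1, h2⟩ := hcon m; exact ⟨(α, β), h1, h2⟩)
    (tcl 0).isCompact tcl
  rw [mem_iInter] at hp
  have : p.1 = p.2 := funext fun i => (hp (i+1)).1 i (by omega)
  have h2 := (hp 0).2
  rw [this, dist_self] at h2
  linarith

theorem mycielski {X : Type} [TopologicalSpace X] [PolishSpace X] [Nonempty X]
    (D : ℕ → Set (X × X)) (ho : ∀ n, IsOpen (D n)) (hd : ∀ n, Dense (D n)) :
    ∃ y : (ℕ → Bool) → X, ∀ α β, α ≠ β → ∀ n, (y α, y β) ∈ D n := by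
  classical
  let _ := TopologicalSpace.upgradeIsCompletelyMetrizable X
  let K : ℕ → Set ((ℕ → Bool) × (ℕ → Bool)) := fun n => {p | ∃ i < n, p.1 i ≠ p.2 i}
  have Kclosed : ∀ n, IsClosed (K n) := by
    intro n
    have : K n = ⋃ i ∈ Finset.range n, {p : (ℕ → Bool) × (ℕ → Bool) | p.1 i ≠ p.2 i} := by
      ext p; simp [K]
    rw [this]
    refine Set.Finite.isClosed_biUnion (Finset.finite_toSet _) (fun i _ => ?_)
    have hc : Continuous (fun p : (ℕ → Bool) × (ℕ → Bool) => (p.1 i, p.2 i)) := by fun_prop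
    exact (isClosed_discrete {q : Bool × Bool | q.1 ≠ q.2}).preimage hc
  let O : ℕ × ℕ → Set C(ℕ → Bool, X) := fun m => {y | MapsTo (y.prodMap y) (K m.1) (D m.2)}
  have Oopen : ∀ m, IsOpen (O m) := by
    intro m
    have hc : Continuous (fun y : C(ℕ → Bool, X) => y.prodMap y) := by
      refine ContinuousMap.continuous_of_continuous_uncurry _ ?_
      show Continuous (fun q : C(ℕ → Bool, X) × ((ℕ → Bool) × (ℕ → Bool)) =>
        (q.1 q.2.1, q.1 q.2.2))
      fun_prop
    exact (ContinuousMap.isOpen_setOfPred_mapsTo (Kclosed m.1).isCompact (ho m.2)).preimage hc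
  have Odense : ∀ m, Dense (O m) := by
    rintro ⟨n, d⟩
    rw [Metric.dense_iff]
    intro y ε hε
    obtain ⟨m, hm⟩ := cantor_unif y (ε / 2) (by linarith)
    let M := max m n
    let ex : (Fin M → Bool) → (ℕ → Bool) := fun s i => if h : i < M then s ⟨i, h⟩ else false
    let res : (ℕ → Bool) → (Fin M → Bool) := fun α i => α i
    obtain ⟨c, hc1, hc2⟩ := finite_generic (D d) (ho d) (hd d) (fun s => y (ex s)) (ε / 2)
      (by linarith)
    have hcont : Continuous (fun α => c (res α)) := by
      have h1 : Continuous c := continuous_of_discreteTopology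
      exact h1.comp (by fun_prop)
    refine ⟨⟨fun α => c (res α), hcont⟩, ?_, ?_⟩
    · rw [Metric.mem_ball, ContinuousMap.dist_lt_iff hε]
      intro α
      have h1 : dist (c (res α)) (y (ex (res α))) < ε / 2 :=
        (dist_pi_lt_iff (by linarith)).1 hc1 (res α)
      have h2 : dist (y (ex (res α))) (y α) < ε / 2 := by
        apply hm
        intro i hi
        have : i < M := lt_of_lt_of_le hi (le_max_left _ _)
        simp [ex, res, this]
      calc _ ≤ _ := dist_triangle _ (y (ex (res α))) _
        _ < ε := by
          show dist (c (res α)) (y (ex (res α))) + _ < ε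
          linarith
    · rintro ⟨α, β⟩ ⟨i, hi, hne⟩
      refine hc2 (res α) (res β) (fun h => hne ?_)
      exact congrFun h ⟨i, lt_of_lt_of_le hi (le_max_right _ _)⟩
  have : Nonempty C(ℕ → Bool, X) := ⟨ContinuousMap.const _ (Classical.arbitrary X)⟩
  obtain ⟨y, hy⟩ := (dense_iInter_of_isOpen Oopen Odense).nonempty
  refine ⟨y, fun α β hne n => ?_⟩
  obtain ⟨i, hi⟩ := Function.ne_iff.1 hne
  have := mem_iInter.1 hy (i+1, n)
  exact this (show (α, β) ∈ K (i+1) from ⟨i, by omega, hi⟩)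
end SIP

end

section

namespace SIP
open Topology Set
variable {G : SimpleGraph ℕ}

/-- Pointwise stabilizer. -/
def Stab (G : SimpleGraph ℕ) (A : Finset ℕ) : Subgroup (G ≃g G) where
  carrier := {g | ∀ a ∈ A, g a = a}
  mul_mem' {g h} hg hh a ha := by
    show g (h a) = a
    rw [hh a ha, hg a ha]
  one_mem' _ _ := rfl
  inv_mem' {g} hg a ha := by
    show g⁻¹ a = a
    conv_lhs => rw [← hg a ha]
    exact RelIso.inv_apply_self g a

/-- The map used for defining the topology. -/
def code (A : Finset ℕ) (g : Stab G A) : (ℕ → ℕ) × (ℕ → ℕ) := (⇑g.1, ⇑(g⁻¹).1)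

/-- The topology of pointwise convergence. -/
instance stabTop (A : Finset ℕ) : TopologicalSpace (Stab G A) :=
  TopologicalSpace.induced (code A) inferInstance

theorem cont_code (A : Finset ℕ) : Continuous (code A : Stab G A → _) := continuous_induced_dom

theorem cont_eval : Continuous (fun p : (ℕ → ℕ) × ℕ => p.1 p.2) := by
  rw [continuous_prod_of_discrete_right]
  intro b
  fun_prop

theorem cont_apply (A : Finset ℕ) (x : ℕ) : Continuous (fun g : Stab G A => g.1 x) :=
  (continuous_apply x).comp (continuous_fst.comp (cont_code A))

theorem cont_apply_inv (A : Finset ℕ) (x : ℕ) : Continuous (fun g : Stab G A => (g⁻¹).1 x) :=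
  (continuous_apply x).comp (continuous_snd.comp (cont_code A))

theorem cont_apply2 (A : Finset ℕ) {Y : Type} [TopologicalSpace Y] (u : Y → Stab G A) (v : Y → ℕ)
    (hu : Continuous u) (hv : Continuous v) : Continuous (fun y => (u y).1 (v y)) :=
  cont_eval.comp (((continuous_fst.comp (cont_code A)).comp hu).prodMk hv)

instance stabGroup (A : Finset ℕ) : IsTopologicalGroup (Stab G A) where
  continuous_mul := by
    refine continuous_induced_rng.2 (Continuous.prodMk (continuous_pi fun x => ?_)
      (continuous_pi fun x => ?_))
    · have : Continuous (fun p : Stab G A × Stab G A => p.1.1 (p.2.1 x)) :=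
        cont_eval.comp (((continuous_fst.comp (cont_code A)).comp continuous_fst).prodMk
          ((cont_apply A x).comp continuous_snd))
      exact this
    · have : Continuous (fun p : Stab G A × Stab G A => (p.2⁻¹).1 ((p.1⁻¹).1 x)) :=
        cont_eval.comp (((continuous_snd.comp (cont_code A)).comp continuous_snd).prodMk
          ((cont_apply_inv A x).comp continuous_fst))
      refine this.congr (fun p => ?_)
      rw [mul_inv_rev]
      rfl
  continuous_inv := by
    refine continuous_induced_rng.2 (Continuous.prodMk (continuous_pi fun x => ?_)
      (continuous_pi fun x => ?_))
    · exact cont_apply_inv A x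
    · refine (cont_apply A x).congr (fun p => ?_)
      simp

theorem code_inj (A : Finset ℕ) : Function.Injective (code A : Stab G A → _) := by
  intro g h hgh
  exact Subtype.ext (DFunLike.coe_injective (congrArg Prod.fst hgh))

theorem code_range (A : Finset ℕ) : range (code A : Stab G A → _) =
    (⋂ x : ℕ, {p : (ℕ → ℕ) × (ℕ → ℕ) | p.1 (p.2 x) = x}) ∩
    (⋂ x : ℕ, {p : (ℕ → ℕ) × (ℕ → ℕ) | p.2 (p.1 x) = x}) ∩
    (⋂ x : ℕ × ℕ, {p : (ℕ → ℕ) × (ℕ → ℕ) | (G.Adj (p.1 x.1) (p.1 x.2) ↔ G.Adj x.1 x.2)}) ∩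
    ⋂ x : A, {p : (ℕ → ℕ) × (ℕ → ℕ) | p.1 x = x} := by
  ext p
  constructor
  · rintro ⟨g, rfl⟩
    refine ⟨⟨⟨?_, ?_⟩, ?_⟩, ?_⟩ <;> refine mem_iInter.2 (fun x => ?_)
    · exact RelIso.apply_inv_self g.1 x
    · exact RelIso.inv_apply_self g.1 x
    · exact g.1.map_adj_iff
    · exact g.2 x x.2
  · rintro ⟨⟨⟨h1, h2⟩, h3⟩, h4⟩
    rw [mem_iInter] at h1 h2 h3 h4
    let g : G ≃g G := ⟨⟨p.1, p.2, h2, h1⟩, fun {a b} => h3 (a, b)⟩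
    exact ⟨⟨g, fun a ha => h4 ⟨a, ha⟩⟩, rfl⟩

theorem code_closed (A : Finset ℕ) : IsClosedEmbedding (code A : Stab G A → _) := by
  refine ⟨⟨⟨rfl⟩, code_inj A⟩, ?_⟩
  rw [code_range]
  refine IsClosed.inter (IsClosed.inter (IsClosed.inter ?_ ?_) ?_) ?_ <;>
    refine isClosed_iInter (fun x => ?_)
  · exact isClosed_eq (cont_eval.comp (continuous_fst.prodMk
      ((continuous_apply x).comp continuous_snd))) continuous_const
  · exact isClosed_eq (cont_eval.comp (continuous_snd.prodMk
      ((continuous_apply x).comp continuous_fst))) continuous_const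
  · have hc : Continuous (fun p : (ℕ → ℕ) × (ℕ → ℕ) => (p.1 x.1, p.1 x.2)) := by fun_prop
    exact (isClosed_discrete {q : ℕ × ℕ | (G.Adj q.1 q.2 ↔ G.Adj x.1 x.2)}).preimage hc
  · exact isClosed_eq (by fun_prop) continuous_const

instance stabPolish (A : Finset ℕ) : PolishSpace (Stab G A) := (code_closed A).polishSpace

theorem stab_open (A : Finset ℕ) (U : Set (Stab G A))
    (h : ∀ x ∈ U, ∃ K : Finset ℕ, ∀ y : Stab G A, (∀ c ∈ K, y.1 c = x.1 c) → y ∈ U) :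
    IsOpen U := by
  rw [isOpen_iff_mem_nhds]
  intro x hx
  obtain ⟨K, hK⟩ := h x hx
  have ho : IsOpen (⋂ c ∈ K, {y : Stab G A | y.1 c = x.1 c}) := by
    refine isOpen_biInter_finset (fun c _ => ?_)
    exact (isOpen_discrete {x.1 c}).preimage (cont_apply A c)
  refine Filter.mem_of_superset (ho.mem_nhds (by simp)) (fun y hy => hK y ?_)
  simpa using hy

theorem stab_basis (A : Finset ℕ) (x : Stab G A) (U : Set (Stab G A)) (hU : U ∈ 𝓝 x) :
    ∃ K : Finset ℕ, ∀ y : Stab G A, (∀ c ∈ K, y.1 c = x.1 c) → y ∈ U := by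
  classical
  have pibasis : ∀ (a : ℕ → ℕ) (V : Set (ℕ → ℕ)), V ∈ 𝓝 a →
      ∃ K : Finset ℕ, ∀ b : ℕ → ℕ, (∀ c ∈ K, b c = a c) → b ∈ V := by
    intro a V hV
    rw [nhds_pi, Filter.mem_pi] at hV
    obtain ⟨I, hI, t, ht, hsub⟩ := hV
    refine ⟨hI.toFinset, fun b hb => hsub (fun i hi => ?_)⟩
    rw [hb i (by simpa using hi)]
    exact mem_of_mem_nhds (ht i)
  rw [nhds_induced, Filter.mem_comap] at hU
  obtain ⟨V, hV, hVU⟩ := hU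
  rw [nhds_prod_eq, Filter.mem_prod_iff] at hV
  obtain ⟨V1, hV1, V2, hV2, hVV⟩ := hV
  obtain ⟨K1, hK1⟩ := pibasis _ _ hV1
  obtain ⟨K2, hK2⟩ := pibasis _ _ hV2
  refine ⟨K1 ∪ K2.image (x⁻¹).1, fun y hy => hVU (hVV ⟨?_, ?_⟩)⟩
  · exact hK1 _ (fun c hc => hy c (Finset.mem_union_left _ hc))
  · refine hK2 _ (fun c hc => ?_)
    have := hy _ (Finset.mem_union_right _ (Finset.mem_image_of_mem _ hc))
    have e1 : x.1 ((x⁻¹).1 c) = c := RelIso.apply_inv_self x.1 c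
    rw [e1] at this
    show (y⁻¹).1 c = (x⁻¹).1 c
    conv_lhs => rw [← this]
    exact RelIso.inv_apply_self y.1 _

theorem stab_dense (A : Finset ℕ) (U : Set (Stab G A))
    (h : ∀ (x : Stab G A) (K : Finset ℕ), ∃ y ∈ U, ∀ c ∈ K, y.1 c = x.1 c) : Dense U := by
  intro x
  rw [mem_closure_iff_nhds]
  intro V hV
  obtain ⟨K, hK⟩ := stab_basis A x V hV
  obtain ⟨y, hy, hyx⟩ := h x K
  exact ⟨y, hK y hyx, hy⟩

/-- Requirements restricted to the stabilizer. -/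
def SReq (A : Finset ℕ) (n : ℕ) (f : ℕ → (G ≃g G))
    (r : Finset ℕ ⊕ (Finset ℕ × Finset (ℕ × ℕ × ℕ))) : Set (Stab G A) := {x | x.1 ∈ Req n f r}

theorem sreq_open (A : Finset ℕ) (n : ℕ) (f : ℕ → (G ≃g G)) (r) : IsOpen (SReq A n f r) := by
  refine stab_open A _ (fun x hx => ?_)
  obtain ⟨K, hK⟩ := req_open n f r x.1 hx
  exact ⟨K, fun y hy => hK y.1 hy⟩

theorem sreq_dense (hG : G.ExtensionProperty) (A : Finset ℕ) {n : ℕ} {f : ℕ → (G ≃g G)}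
    (hf : Good n f) (r) : Dense (SReq A n f r) := by
  classical
  refine stab_dense A _ (fun x K => ?_)
  obtain ⟨y, hy, hyx⟩ := req_dense hG hf r x.1 (K ∪ A)
  refine ⟨⟨y, fun a ha => ?_⟩, hy, fun c hc => hyx c (Finset.mem_union_left _ hc)⟩
  rw [hyx a (Finset.mem_union_right _ ha)]
  exact x.2 a ha

theorem card_le {Γ : Type} [Group Γ] (H : Subgroup Γ) (y : (ℕ → Bool) → Γ)
    (hy : ∀ α β, α ≠ β → (y α)⁻¹ * y β ∉ H) : 2 ^ Cardinal.aleph0 ≤ Cardinal.mk (Γ ⧸ H) := by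
  have hinj : Function.Injective (fun α => (QuotientGroup.mk (y α) : Γ ⧸ H)) := by
    intro α β h
    by_contra hne
    exact hy α β hne (QuotientGroup.eq.1 h)
  have := Cardinal.mk_le_of_injective hinj
  simpa using this

theorem exists_in (hG : G.ExtensionProperty) (H : Subgroup (G ≃g G))
    (hindex : Cardinal.mk ((G ≃g G) ⧸ H) < 2 ^ Cardinal.aleph0)
    {n : ℕ} {f : ℕ → (G ≃g G)} (hf : Good n f) (A : Finset ℕ) :
    ∃ x ∈ H, (∀ a ∈ A, x a = a) ∧ Good (n+1) (Function.update f n x) := by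
  by_contra hcon
  push Not at hcon
  obtain ⟨e, he⟩ := exists_surjective_nat (Finset ℕ ⊕ (Finset ℕ × Finset (ℕ × ℕ × ℕ)))
  have hopen : IsOpenMap (fun p : Stab G A × Stab G A => p.1⁻¹ * p.2) :=
    isOpenMap_snd.comp (Homeomorph.shearMulRight (Stab G A)).symm.isOpenMap
  have hcont : Continuous (fun p : Stab G A × Stab G A => p.1⁻¹ * p.2) := by fun_prop
  obtain ⟨y, hy⟩ := mycielski
    (fun m => (fun p : Stab G A × Stab G A => p.1⁻¹ * p.2) ⁻¹' (SReq A n f (e m)))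
    (fun m => (sreq_open A n f (e m)).preimage hcont)
    (fun m => (sreq_dense hG A hf (e m)).preimage hopen)
  refine absurd (card_le H (fun α => (y α).1) (fun α β hne hmem => ?_)) (not_le.2 hindex)
  refine hcon _ hmem ((y α)⁻¹ * y β).2 (req_good _ (fun r => ?_))
  obtain ⟨m, rfl⟩ := he r
  exact hy α β hne m

theorem exists_out (hG : G.ExtensionProperty) (H : Subgroup (G ≃g G))
    {n : ℕ} {f : ℕ → (G ≃g G)} (hf : Good n f) (A : Finset ℕ)
    (hA : ∃ g : G ≃g G, (∀ a ∈ A, g a = a) ∧ g ∉ H) :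
    ∃ x, x ∉ H ∧ (∀ a ∈ A, x a = a) ∧ Good (n+1) (Function.update f n x) := by
  by_contra hcon
  push Not at hcon
  obtain ⟨g, hgA, hgH⟩ := hA
  let g' : Stab G A := ⟨g, hgA⟩
  have hd1 := dense_iInter_of_isOpen (f := SReq A n f) (sreq_open A n f) (sreq_dense hG A hf)
  have hd2 := dense_iInter_of_isOpen
    (f := fun r : Bool × (Finset ℕ ⊕ (Finset ℕ × Finset (ℕ × ℕ × ℕ))) =>
      (fun x => (if r.1 then g' else 1) * x) ⁻¹' SReq A n f r.2)
    (fun r => (sreq_open A n f r.2).preimage (by fun_prop))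
    (fun r => (sreq_dense hG A hf r.2).preimage (isOpenMap_mul_left _))
  obtain ⟨x, hx⟩ := hd2.nonempty
  rw [mem_iInter] at hx
  have hin : ∀ z : Stab G A, (∀ r, z ∈ SReq A n f r) → z.1 ∈ H := by
    intro z hz
    by_contra hzH
    exact hcon z.1 hzH z.2 (req_good _ hz)
  have h1 : x.1 ∈ H := hin x (fun r => by simpa using hx (false, r))
  have h2 : (g' * x).1 ∈ H := hin _ (fun r => by simpa using hx (true, r))
  exact hgH ((Subgroup.mul_mem_cancel_right H h1).1 h2)

end SIP

end

section

namespace SIP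
variable {G : SimpleGraph ℕ}

theorem step1 (hG : G.ExtensionProperty) (H : Subgroup (G ≃g G))
    (hindex : Cardinal.mk ((G ≃g G) ⧸ H) < 2 ^ Cardinal.aleph0)
    (hno : ∀ A : Finset ℕ, ∃ g : G ≃g G, (∀ a ∈ A, g a = a) ∧ g ∉ H)
    {n : ℕ} {f : ℕ → (G ≃g G)} (hf : Good n f) (h : G ≃g G) :
    ∃ x0 x1 k : G ≃g G, x0 ∈ H ∧ x1 ∉ H ∧ Good (n+1) (Function.update f n x0) ∧
      Good (n+1) (Function.update f n x1) ∧ (∀ x ≤ n, k x = x) ∧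
      (∀ x ≤ n, k (h⁻¹ x) = h⁻¹ x) ∧ (∀ i < n, k * f i = f i * k) ∧ k * x1 = x0 * k := by
  classical
  obtain ⟨A, hA, hinv⟩ := hf.lf (Finset.range (n+1) ∪ (Finset.range (n+1)).image (h⁻¹ : G ≃g G))
  obtain ⟨x0, h0H, h0A, h0g⟩ := exists_in hG H hindex hf A
  obtain ⟨x1, h1H, h1A, h1g⟩ := exists_out hG H hf A (hno A)
  have hinv' : Inv (n+1) (Function.update f n x1) A := by
    intro i hi c hc
    rcases Nat.lt_succ_iff_lt_or_eq.1 hi with h | rfl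
    · rw [Function.update_of_ne h.ne]
      exact hinv i h c hc
    · rw [Function.update_self, h1A c hc]
      exact hc
  obtain ⟨k, hk1, hk2⟩ := conj_good h1g h0g A hinv' 1 (by
    intro i hi c hc
    rcases Nat.lt_succ_iff_lt_or_eq.1 hi with h | rfl
    · rw [Function.update_of_ne h.ne, Function.update_of_ne h.ne]
      rfl
    · rw [Function.update_self, Function.update_self]
      show x1 c = x0 c
      rw [h1A c hc, h0A c hc])
  refine ⟨x0, x1, k, h0H, h1H, h0g, h1g, ?_, ?_, ?_, ?_⟩
  · intro x hx
    exact hk1 x (hA (Finset.mem_union_left _ (Finset.mem_range.2 (by omega))))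
  · intro x hx
    exact hk1 _ (hA (Finset.mem_union_right _
      (Finset.mem_image_of_mem _ (Finset.mem_range.2 (by omega)))))
  · intro i hi
    ext x
    have := hk2 i (by omega) x
    rw [Function.update_of_ne hi.ne, Function.update_of_ne hi.ne] at this
    exact this
  · ext x
    have := hk2 n (by omega) x
    rw [Function.update_self, Function.update_self] at this
    exact this

/-- States of the tree construction. -/
abbrev TState (G : SimpleGraph ℕ) (n : ℕ) : Type :=
  {p : (ℕ → (G ≃g G)) × (G ≃g G) // Good n p.1}

theorem step2 (hG : G.ExtensionProperty) (H : Subgroup (G ≃g G))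
    (hindex : Cardinal.mk ((G ≃g G) ⧸ H) < 2 ^ Cardinal.aleph0)
    (hno : ∀ A : Finset ℕ, ∃ g : G ≃g G, (∀ a ∈ A, g a = a) ∧ g ∉ H) :
    ∃ nx : ∀ n, TState G n → Bool → TState G (n+1),
      (∀ n s b, ∀ i < n, (nx n s b).1.1 i = s.1.1 i) ∧
      (∀ n s b, ∀ x ≤ n, (nx n s b).1.2 x = s.1.2 x) ∧
      (∀ n s b, ∀ x ≤ n, (nx n s b).1.2⁻¹ x = s.1.2⁻¹ x) ∧
      (∀ n s b, ∀ i < n, (nx n s b).1.2 * s.1.1 i * (nx n s b).1.2⁻¹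
        = s.1.2 * s.1.1 i * s.1.2⁻¹) ∧
      (∀ n s, (nx n s false).1.2 * (nx n s false).1.1 n * (nx n s false).1.2⁻¹ =
        (nx n s true).1.2 * (nx n s true).1.1 n * (nx n s true).1.2⁻¹) ∧
      (∀ n s, (nx n s false).1.1 n ∈ H) ∧ (∀ n s, (nx n s true).1.1 n ∉ H) := by
  have key := fun (n : ℕ) (s : TState G n) => step1 hG H hindex hno s.2 s.1.2
  choose x0 x1 k h0 h1 g0 g1 k1 k2 k3 k4 using key
  refine ⟨fun n s b => match b with
    | false => ⟨(Function.update s.1.1 n (x0 n s), s.1.2), g0 n s⟩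
    | true => ⟨(Function.update s.1.1 n (x1 n s), s.1.2 * k n s), g1 n s⟩,
    ?_, ?_, ?_, ?_, ?_, ?_, ?_⟩
  · rintro n s (_ | _) i hi
    · exact Function.update_of_ne hi.ne _ _
    · exact Function.update_of_ne hi.ne _ _
  · rintro n s (_ | _) x hx
    · rfl
    · show s.1.2 (k n s x) = _
      rw [k1 n s x hx]
  · rintro n s (_ | _) x hx
    · rfl
    · show (s.1.2 * k n s)⁻¹ x = _
      rw [mul_inv_rev]
      show (k n s)⁻¹ (s.1.2⁻¹ x) = _
      conv_lhs => rw [← k2 n s x hx]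
      exact RelIso.inv_apply_self _ _
  · rintro n s (_ | _) i hi
    · rfl
    · show s.1.2 * k n s * s.1.1 i * (s.1.2 * k n s)⁻¹ = _
      rw [mul_assoc s.1.2, k3 n s i hi]
      group
  · intro n s
    show s.1.2 * (Function.update s.1.1 n (x0 n s) n) * s.1.2⁻¹ =
      s.1.2 * k n s * (Function.update s.1.1 n (x1 n s) n) * (s.1.2 * k n s)⁻¹
    rw [Function.update_self, Function.update_self, mul_assoc s.1.2 (k n s), k4 n s]
    group
  · intro n s
    show Function.update s.1.1 n (x0 n s) n ∈ H
    rw [Function.update_self]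
    exact h0 n s
  · intro n s
    show Function.update s.1.1 n (x1 n s) n ∉ H
    rw [Function.update_self]
    exact h1 n s

/-- The branch of the tree. -/
def branch (nx : ∀ n, TState G n → Bool → TState G (n+1)) (s0 : TState G 0) (α : ℕ → Bool) :
    ∀ n, TState G n
  | 0 => s0
  | n+1 => nx n (branch nx s0 α n) (α n)

theorem branch_congr (nx : ∀ n, TState G n → Bool → TState G (n+1)) (s0 : TState G 0)
    (α β : ℕ → Bool) (n : ℕ) (h : ∀ i < n, α i = β i) :
    branch nx s0 α n = branch nx s0 β n := by
  induction n with
  | zero => rfl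
  | succ n ih =>
    show nx n _ _ = nx n _ _
    rw [ih (fun i hi => h i (by omega)), h n (by omega)]

/-- Limits of automorphisms. -/
theorem aut_lim (h : ℕ → (G ≃g G)) (h1 : ∀ n, ∀ x ≤ n, h (n+1) x = h n x)
    (h2 : ∀ n, ∀ x ≤ n, (h (n+1))⁻¹ x = (h n)⁻¹ x) :
    ∃ k : G ≃g G, ∀ x n, x ≤ n → k x = h n x := by
  obtain ⟨k, hk⟩ := seqlim (fun n => (h n).toEquiv) h1 h2
  have hk' : ∀ x n, x ≤ n → k x = h n x := hk
  refine ⟨⟨k, fun {a b} => ?_⟩, hk'⟩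
  rw [hk' a (max a b) (le_max_left _ _), hk' b (max a b) (le_max_right _ _)]
  exact (h (max a b)).map_adj_iff

theorem main (hG : G.ExtensionProperty) (H : Subgroup (G ≃g G))
    (hindex : Cardinal.mk ((G ≃g G) ⧸ H) < 2 ^ Cardinal.aleph0) :
    ∃ A : Set ℕ, A.Finite ∧ ∀ g : G ≃g G, (∀ a ∈ A, g a = a) → g ∈ H := by
  by_contra hcon
  push Not at hcon
  have hno : ∀ A : Finset ℕ, ∃ g : G ≃g G, (∀ a ∈ A, g a = a) ∧ g ∉ H := by
    intro A
    obtain ⟨g, hg, hgH⟩ := hcon A A.finite_toSet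
    exact ⟨g, fun a ha => hg a (Finset.mem_coe.2 ha), hgH⟩
  obtain ⟨nx, n1, n2, n3, n4, n5, n6, n7⟩ := step2 hG H hindex hno
  let s0 : TState G 0 := ⟨(fun _ => 1, 1), good_zero _⟩
  let st := branch nx s0
  have hst : ∀ α n, st α (n+1) = nx n (st α n) (α n) := fun _ _ => rfl
  have hlim := fun α => aut_lim (fun n => (st α n).1.2)
    (fun n x hx => n2 n (st α n) (α n) x hx) (fun n x hx => n3 n (st α n) (α n) x hx)
  choose y hy using hlim
  have stable : ∀ α i m, i + 1 ≤ m → (st α m).1.1 i = (st α (i+1)).1.1 i ∧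
      (st α m).1.2 * (st α m).1.1 i * (st α m).1.2⁻¹ =
        (st α (i+1)).1.2 * (st α (i+1)).1.1 i * (st α (i+1)).1.2⁻¹ := by
    intro α i m hm
    induction m, hm using Nat.le_induction with
    | base => exact ⟨rfl, rfl⟩
    | succ m hm ih =>
      rw [← ih.2, ← ih.1, hst α m]
      refine ⟨n1 _ _ _ i hm, ?_⟩
      rw [n1 _ _ _ i hm]
      exact n4 _ _ _ i hm
  have hconj : ∀ α i, y α * (st α (i+1)).1.1 i * (y α)⁻¹ =
      (st α (i+1)).1.2 * (st α (i+1)).1.1 i * (st α (i+1)).1.2⁻¹ := by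
    intro α i
    rw [mul_inv_eq_iff_eq_mul]
    ext x
    let m := max (max x ((st α (i+1)).1.1 i x)) (i+1)
    have hs := stable α i m (le_max_right _ _)
    rw [hs.1, mul_inv_eq_iff_eq_mul] at hs
    have e := DFunLike.congr_fun hs.2 x
    have e1 := hy α x m ((le_max_left _ _).trans (le_max_left _ _))
    have e2 := hy α _ m ((le_max_right x ((st α (i+1)).1.1 i x)).trans (le_max_left _ _))
    show y α ((st α (i+1)).1.1 i x) =
      ((st α (i+1)).1.2 * (st α (i+1)).1.1 i * (st α (i+1)).1.2⁻¹) (y α x)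
    rw [e2, e1]
    exact e
  have half : ∀ α β n, (∀ i < n, α i = β i) → α n = false → β n = true →
      (y α)⁻¹ * y β ∉ H := by
    intro α β n hlt ha hb hmem
    have hαβ : st α n = st β n := branch_congr nx s0 α β n hlt
    have e := n5 n (st β n)
    have ea := hconj α n
    have eb := hconj β n
    rw [hst, ha, hαβ, e] at ea
    rw [hst, hb] at eb
    rw [← eb] at ea
    have hx0 := n6 n (st β n)
    refine n7 n (st β n) ?_
    have : (nx n (st β n) true).1.1 n = ((y α)⁻¹ * y β)⁻¹ *
        (nx n (st β n) false).1.1 n * ((y α)⁻¹ * y β) := by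
      have : (nx n (st β n) true).1.1 n =
          (y β)⁻¹ * (y α * (nx n (st β n) false).1.1 n * (y α)⁻¹) * y β := by
        rw [ea]; group
      rw [this]; group
    rw [this]
    exact H.mul_mem (H.mul_mem (H.inv_mem hmem) hx0) hmem
  refine absurd (card_le H y (fun α β hne hmem => ?_)) (not_le.2 hindex)
  have hex : ∃ n, α n ≠ β n := Function.ne_iff.1 hne
  classical
  have hn := Nat.find_spec hex
  have hlt : ∀ i < Nat.find hex, α i = β i := fun i hi => not_not.1 (Nat.find_min hex hi)
  cases ha : α (Nat.find hex) with
  | false =>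
    refine half α β _ hlt ha ?_ hmem
    rw [ha] at hn
    simpa using hn.symm
  | true =>
    refine half β α _ (fun i hi => (hlt i hi).symm) ?_ ha ?_
    · rw [ha] at hn
      simpa using hn.symm
    · have := H.inv_mem hmem
      rwa [mul_inv_rev, inv_inv] at this

end SIP

end

/-- Small index property for the random graph (Hodges–Hodkinson–Lascar–Shelah):
any subgroup of `Aut(G)` of index `< 2^ℵ₀` contains the pointwise stabilizer of a
finite set of vertices. -/
theorem smallIndexProperty_randomGraph (G : SimpleGraph ℕ)
    (hG : G.ExtensionProperty) (H : Subgroup (G ≃g G))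
    (hindex : Cardinal.mk ((G ≃g G) ⧸ H) < 2 ^ Cardinal.aleph0) :
    ∃ A : Set ℕ, A.Finite ∧ ∀ g : G ≃g G, (∀ a ∈ A, g a = a) → g ∈ H := by
  exact SIP.main hG H hindex
end

section
/- In the group Aut(ℚ,<) of all order-automorphisms of the rational numbers, equipped with the topology of pointwise convergence, there exists an element whose conjugacy class is comeagre (i.e. contains a countable intersection of dense open subsets). -/
/-- The topology of pointwise convergence on `Aut(ℚ,<)`: the topology induced from the
product topology on `ℚ → ℚ`, where `ℚ` carries the discrete topology. -/
def orderAutRatPointwiseTopology : TopologicalSpace (ℚ ≃o ℚ) :=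
  TopologicalSpace.induced (fun g : ℚ ≃o ℚ => (g : ℚ → ℚ))
    (@Pi.topologicalSpace ℚ (fun _ => ℚ) (fun _ => ⊥))

namespace GenericRat

/-! ### Coloured back-and-forth -/

section BackForth

/-- Every colour occurs in every open interval (including unbounded ones). -/
structure Rich {L K : Type*} [LinearOrder L] (c : L → K) : Prop where
  mid : ∀ a b, a < b → ∀ k, ∃ x, a < x ∧ x < b ∧ c x = k
  up : ∀ a k, ∃ x, a < x ∧ c x = k
  down : ∀ a k, ∃ x, x < a ∧ c x = k
  ne : ∀ k, ∃ x, c x = k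

theorem Rich.between {L K : Type*} [LinearOrder L] {c : L → K} (H : Rich c)
    (lo hi : Finset L) (h : ∀ x ∈ lo, ∀ y ∈ hi, x < y) (k : K) :
    ∃ m, (∀ x ∈ lo, x < m) ∧ (∀ y ∈ hi, m < y) ∧ c m = k := by
  by_cases nlo : lo.Nonempty
  · by_cases nhi : hi.Nonempty
    · obtain ⟨m, h1, h2, h3⟩ := H.mid _ _ (h _ (Finset.max'_mem _ nlo) _ (Finset.min'_mem _ nhi)) k
      exact ⟨m, fun x hx => (Finset.le_max' lo x hx).trans_lt h1,
        fun y hy => h2.trans_le (Finset.min'_le hi y hy), h3⟩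
    · obtain ⟨m, h1, h3⟩ := H.up (lo.max' nlo) k
      exact ⟨m, fun x hx => (Finset.le_max' lo x hx).trans_lt h1,
        fun y hy => (nhi ⟨y, hy⟩).elim, h3⟩
  · by_cases nhi : hi.Nonempty
    · obtain ⟨m, h2, h3⟩ := H.down (hi.min' nhi) k
      exact ⟨m, fun x hx => (nlo ⟨x, hx⟩).elim,
        fun y hy => h2.trans_le (Finset.min'_le hi y hy), h3⟩
    · obtain ⟨m, h3⟩ := H.ne k
      exact ⟨m, fun x hx => (nlo ⟨x, hx⟩).elim, fun y hy => (nhi ⟨y, hy⟩).elim, h3⟩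

/-- Finite partial coloured isomorphism. -/
def IsPIso {L M K : Type*} [LinearOrder L] [LinearOrder M] (c : L → K) (d : M → K)
    (f : Finset (L × M)) : Prop :=
  (∀ p ∈ f, ∀ q ∈ f, p.1 < q.1 ↔ p.2 < q.2) ∧ ∀ p ∈ f, c p.1 = d p.2

theorem IsPIso.eq_iff {L M K : Type*} [LinearOrder L] [LinearOrder M] {c : L → K} {d : M → K}
    {f : Finset (L × M)} (hf : IsPIso c d f) {p q : L × M} (hp : p ∈ f) (hq : q ∈ f) :
    p.1 = q.1 ↔ p.2 = q.2 := by
  have h1 := hf.1 p hp q hq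
  have h2 := hf.1 q hq p hp
  constructor
  · intro h
    rw [h] at h1 h2
    simp only [lt_self_iff_false, false_iff] at h1 h2
    exact le_antisymm (not_lt.1 h2) (not_lt.1 h1)
  · intro h
    rw [h] at h1 h2
    simp only [lt_self_iff_false, iff_false] at h1 h2
    exact le_antisymm (not_lt.1 h2) (not_lt.1 h1)

open Classical in
theorem IsPIso.extend {L M K : Type*} [LinearOrder L] [LinearOrder M] {c : L → K} {d : M → K}
    (H : Rich d) {f : Finset (L × M)} (hf : IsPIso c d f) (a : L) :
    ∃ b, IsPIso c d (insert (a, b) f) := by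
  by_cases h : ∃ b, (a, b) ∈ f
  · obtain ⟨b, hb⟩ := h
    exact ⟨b, by rwa [Finset.insert_eq_of_mem hb]⟩
  have key : ∀ x ∈ (f.filter (fun p => p.1 < a)).image Prod.snd,
      ∀ y ∈ (f.filter (fun p => a < p.1)).image Prod.snd, x < y := by
    intro x hx y hy
    simp only [Finset.mem_image, Finset.mem_filter] at hx hy
    obtain ⟨p, ⟨hp, hpa⟩, rfl⟩ := hx
    obtain ⟨q, ⟨hq, hqa⟩, rfl⟩ := hy
    exact (hf.1 p hp q hq).1 (hpa.trans hqa)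
  obtain ⟨b, h1, h2, h3⟩ := H.between _ _ key (c a)
  have g1 : ∀ p ∈ f, p.1 < a → p.2 < b := fun p hp hpa =>
    h1 _ (Finset.mem_image.2 ⟨p, Finset.mem_filter.2 ⟨hp, hpa⟩, rfl⟩)
  have g2 : ∀ p ∈ f, a < p.1 → b < p.2 := fun p hp hpa =>
    h2 _ (Finset.mem_image.2 ⟨p, Finset.mem_filter.2 ⟨hp, hpa⟩, rfl⟩)
  have g3 : ∀ p ∈ f, p.1 < a ∨ a < p.1 := by
    intro p hp
    refine lt_or_gt_of_ne fun he => h ⟨p.2, ?_⟩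
    rw [← he]; exact hp
  refine ⟨b, ?_, ?_⟩
  · intro p hp q hq
    rw [Finset.mem_insert] at hp hq
    rcases hp with rfl | hp <;> rcases hq with rfl | hq
    · simp
    · rcases g3 q hq with h | h
      · exact iff_of_false h.not_gt (g1 q hq h).not_gt
      · exact iff_of_true h (g2 q hq h)
    · rcases g3 p hp with h | h
      · exact iff_of_true h (g1 p hp h)
      · exact iff_of_false h.not_gt (g2 p hp h).not_gt
    · exact hf.1 p hp q hq
  · intro p hp
    rw [Finset.mem_insert] at hp
    rcases hp with rfl | hp
    · exact h3.symm
    · exact hf.2 p hp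

open Classical in
theorem IsPIso.swap {L M K : Type*} [LinearOrder L] [LinearOrder M] {c : L → K} {d : M → K}
    {f : Finset (L × M)} (hf : IsPIso c d f) : IsPIso d c (f.image Prod.swap) := by
  constructor
  · intro p hp q hq
    obtain ⟨p, hp', rfl⟩ := Finset.mem_image.1 hp
    obtain ⟨q, hq', rfl⟩ := Finset.mem_image.1 hq
    exact (hf.1 p hp' q hq').symm
  · intro p hp
    obtain ⟨p, hp', rfl⟩ := Finset.mem_image.1 hp
    exact (hf.2 p hp').symm

open Classical in
theorem IsPIso.extend_right {L M K : Type*} [LinearOrder L] [LinearOrder M] {c : L → K}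
    {d : M → K} (H : Rich c) {f : Finset (L × M)} (hf : IsPIso c d f) (b : M) :
    ∃ a, IsPIso c d (insert (a, b) f) := by
  obtain ⟨a, ha⟩ := hf.swap.extend H b
  refine ⟨a, ?_⟩
  have := ha.swap
  rw [Finset.image_insert, Finset.image_image] at this
  simpa using this

theorem exists_colour_iso {L M K : Type*} [LinearOrder L] [LinearOrder M] [Countable L]
    [Countable M] {c : L → K} {d : M → K} (Hc : Rich c) (Hd : Rich d) :
    ∃ e : L ≃o M, ∀ x, d (e x) = c x := by
  classical
  cases nonempty_encodable L
  cases nonempty_encodable M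
  let P := {f : Finset (L × M) // IsPIso c d f}
  let D : L ⊕ M → Order.Cofinal P := fun s => Sum.rec
    (fun a => ⟨{f | ∃ b, (a, b) ∈ f.1}, fun f => by
      obtain ⟨b, hb⟩ := f.2.extend Hd a
      exact ⟨⟨_, hb⟩, ⟨b, Finset.mem_insert_self _ _⟩, Finset.subset_insert _ _⟩⟩)
    (fun b => ⟨{f | ∃ a, (a, b) ∈ f.1}, fun f => by
      obtain ⟨a, ha⟩ := f.2.extend_right Hc b
      exact ⟨⟨_, ha⟩, ⟨a, Finset.mem_insert_self _ _⟩, Finset.subset_insert _ _⟩⟩) s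
  let p0 : P := ⟨∅, by simp [IsPIso]⟩
  let I := Order.idealOfCofinals p0 D
  have hl : ∀ a, ∃ b, ∃ f ∈ I, (a, b) ∈ f.1 := by
    intro a
    obtain ⟨f, ⟨b, hb⟩, hf⟩ := Order.cofinal_meets_idealOfCofinals p0 D (Sum.inl a)
    exact ⟨b, f, hf, hb⟩
  have hr : ∀ b, ∃ a, ∃ f ∈ I, (a, b) ∈ f.1 := by
    intro b
    obtain ⟨f, ⟨a, hb⟩, hf⟩ := Order.cofinal_meets_idealOfCofinals p0 D (Sum.inr b)
    exact ⟨a, f, hf, hb⟩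
  choose F hF using hl
  have hmono : StrictMono F := by
    intro a a' haa
    obtain ⟨f, hf, h1⟩ := hF a
    obtain ⟨f', hf', h2⟩ := hF a'
    obtain ⟨m, _, hm, hm'⟩ := I.directed _ hf _ hf'
    exact (m.2.1 _ (hm h1) _ (hm' h2)).1 haa
  have hsurj : Function.Surjective F := by
    intro b
    obtain ⟨a, f, hf, h1⟩ := hr b
    obtain ⟨f', hf', h2⟩ := hF a
    obtain ⟨m, _, hm, hm'⟩ := I.directed _ hf _ hf'
    exact ⟨a, (m.2.eq_iff (hm' h2) (hm h1)).1 rfl⟩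
  refine ⟨hmono.orderIsoOfSurjective F hsurj, fun x => ?_⟩
  obtain ⟨f, hf, h1⟩ := hF x
  exact (f.2.2 _ h1).symm

end BackForth
/-! ### Piecewise automorphisms and the topology -/

section Top

/-- Glue two automorphisms agreeing at `p`. -/
theorem exists_glue (g h : ℚ ≃o ℚ) (p : ℚ) (hp : g p = h p) :
    ∃ k : ℚ ≃o ℚ, (∀ t ≤ p, k t = g t) ∧ (∀ t, p ≤ t → k t = h t) := by
  classical
  let F : ℚ → ℚ := fun t => if t ≤ p then g t else h t
  have F1 : ∀ t ≤ p, F t = g t := fun t ht => if_pos ht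
  have F2 : ∀ t, p ≤ t → F t = h t := by
    intro t ht
    rcases ht.eq_or_lt with rfl | ht
    · rw [F1 _ le_rfl, hp]
    · exact if_neg ht.not_ge
  have hm : StrictMono F := by
    intro s t hst
    rcases le_total t p with h1 | h1
    · rw [F1 _ h1, F1 _ (hst.le.trans h1)]; exact g.strictMono hst
    · rcases le_total s p with h2 | h2
      · rw [F1 _ h2, F2 _ h1]
        rcases h2.eq_or_lt with rfl | h2
        · rw [hp]; exact h.strictMono hst
        · calc g s < g p := g.strictMono h2
            _ = h p := hp
            _ ≤ h t := h.monotone h1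
      · rw [F2 _ h2, F2 _ h1]; exact h.strictMono hst
  have hs : Function.Surjective F := by
    intro y
    rcases le_total y (g p) with h1 | h1
    · refine ⟨g.symm y, ?_⟩
      rw [F1 _ (by rwa [g.symm_apply_le]), g.apply_symm_apply]
    · refine ⟨h.symm y, ?_⟩
      rw [F2 _ (by rwa [h.le_symm_apply, ← hp]), h.apply_symm_apply]
  exact ⟨hm.orderIsoOfSurjective F hs, F1, F2⟩

/-- An affine automorphism with two prescribed values. -/
theorem exists_affine (a b a' b' : ℚ) (h : a < b) (h' : a' < b') :
    ∃ k : ℚ ≃o ℚ, k a = a' ∧ k b = b' := by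
  have hr : 0 < (b' - a') / (b - a) := div_pos (by linarith) (by linarith)
  set r := (b' - a') / (b - a) with hrd
  have hm : StrictMono (fun t : ℚ => a' + (t - a) * r) := by
    intro s t hst
    have := mul_lt_mul_of_pos_right (sub_lt_sub_right hst a) hr
    simpa using this
  have hs : Function.Surjective (fun t : ℚ => a' + (t - a) * r) := by
    intro y
    refine ⟨a + (y - a') / r, ?_⟩
    field_simp
    ring
  refine ⟨hm.orderIsoOfSurjective _ hs, ?_, ?_⟩
  · change a' + (a - a) * r = a'
    simp
  · change a' + (b - a) * r = b'
    have : b - a ≠ 0 := by linarith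
    rw [hrd]; field_simp; ring

theorem exists_bump (e x y w : ℚ) (h1 : e < x) (h2 : x < w) (h3 : e < y) (h4 : y < w) :
    ∃ k : ℚ ≃o ℚ, k x = y ∧ (∀ t ≤ e, k t = t) ∧ ∀ t, w ≤ t → k t = t := by
  obtain ⟨A, A1, A2⟩ := exists_affine e x e y h1 h3
  obtain ⟨B, B1, B2⟩ := exists_affine x w y w h2 h4
  obtain ⟨k1, k1l, k1r⟩ := exists_glue (OrderIso.refl ℚ) A e (by simp [A1])
  obtain ⟨k2, k2l, k2r⟩ := exists_glue k1 B x (by rw [k1r _ h1.le, A2, B1])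
  obtain ⟨k3, k3l, k3r⟩ := exists_glue k2 (OrderIso.refl ℚ) w (by rw [k2r _ h2.le, B2]; rfl)
  refine ⟨k3, ?_, ?_, ?_⟩
  · rw [k3l _ h2.le, k2r _ le_rfl, B1]
  · intro t ht
    rw [k3l _ (by linarith), k2l _ (by linarith), k1l _ ht]; rfl
  · intro t ht
    rw [k3r _ ht]; rfl

/-- Modify an automorphism inside `(e,w)`. -/
theorem exists_modify (g : ℚ ≃o ℚ) (e w c c' : ℚ) (h1 : e < c) (h2 : c < w) (h3 : g e < c')
    (h4 : c' < g w) :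
    ∃ h : ℚ ≃o ℚ, h c = c' ∧ (∀ t ≤ e, h t = g t) ∧ ∀ t, w ≤ t → h t = g t := by
  obtain ⟨k, k1, k2, k3⟩ := exists_bump e c (g.symm c') w h1 h2
    (by rwa [g.lt_symm_apply]) (by rwa [g.symm_apply_lt])
  refine ⟨k.trans g, ?_, ?_, ?_⟩
  · simp [k1]
  · intro t ht; simp [k2 t ht]
  · intro t ht; simp [k3 t ht]

theorem isOpen_aux {X D : Type*} [TopologicalSpace D] [DiscreteTopology D] {I : Type*}
    (i : X → I → D) (U : Set X)
    (hU : ∀ g ∈ U, ∃ F : Finset I, ∀ h, (∀ x ∈ F, i h x = i g x) → h ∈ U) :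
    @IsOpen X (TopologicalSpace.induced i inferInstance) U := by
  let : TopologicalSpace X := TopologicalSpace.induced i inferInstance
  have hc : Continuous i := continuous_induced_dom
  rw [isOpen_iff_forall_mem_open]
  intro g hg
  obtain ⟨F, hF⟩ := hU g hg
  refine ⟨{h | ∀ x ∈ F, i h x = i g x}, hF, ?_, fun x _ => rfl⟩
  have : {h | ∀ x ∈ F, i h x = i g x} = ⋂ x ∈ F, (fun h => i h x) ⁻¹' {i g x} := by
    ext h; simp
  rw [this]
  exact isOpen_biInter_finset fun x _ =>
    (isOpen_discrete _).preimage ((continuous_apply x).comp hc)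

theorem dense_aux {X D : Type*} [TopologicalSpace D] {I : Type*}
    (i : X → I → D) (U : Set X)
    (hU : ∀ g, ∀ F : Finset I, ∃ h ∈ U, ∀ x ∈ F, i h x = i g x) :
    @Dense X (TopologicalSpace.induced i inferInstance) U := by
  let : TopologicalSpace X := TopologicalSpace.induced i inferInstance
  rw [dense_iff_inter_open]
  rintro V hV ⟨g, hg⟩
  obtain ⟨W, hW, rfl⟩ := isOpen_induced_iff.1 hV
  obtain ⟨F, u, hu, hsub⟩ := isOpen_pi_iff.1 hW _ hg
  obtain ⟨h, hh, hF⟩ := hU g F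
  refine ⟨h, hsub ?_, hh⟩
  intro x hx
  rw [hF x hx]
  exact (hu x hx).2

theorem mem_residual_aux (U : Set (ℚ ≃o ℚ))
    (hO : ∀ g ∈ U, ∃ F : Finset ℚ, ∀ h : ℚ ≃o ℚ, (∀ x ∈ F, h x = g x) → h ∈ U)
    (hD : ∀ g : ℚ ≃o ℚ, ∀ F : Finset ℚ, ∃ h ∈ U, ∀ x ∈ F, h x = g x) :
    U ∈ @residual (ℚ ≃o ℚ) orderAutRatPointwiseTopology := by
  refine @residual_of_dense_open _ orderAutRatPointwiseTopology _ ?_ ?_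
  · exact @isOpen_aux (ℚ ≃o ℚ) ℚ ⊥ (@DiscreteTopology.mk _ ⊥ rfl) ℚ (fun g x => g x) U hO
  · exact @dense_aux (ℚ ≃o ℚ) ℚ ⊥ ℚ (fun g x => g x) U hD

theorem pow_locally_const (g : ℚ ≃o ℚ) (n : ℕ) (x : ℚ) :
    ∃ F : Finset ℚ, ∀ h : ℚ ≃o ℚ, (∀ t ∈ F, h t = g t) → (h ^ n) x = (g ^ n) x := by
  classical
  induction n with
  | zero => exact ⟨∅, fun h _ => rfl⟩
  | succ n ih =>
    obtain ⟨F, hF⟩ := ih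
    refine ⟨insert ((g ^ n) x) F, fun h hh => ?_⟩
    rw [pow_succ', pow_succ', RelIso.mul_apply, RelIso.mul_apply,
      hF h fun t ht => hh t (Finset.mem_insert_of_mem ht)]
    exact hh _ (Finset.mem_insert_self _ _)

theorem zpow_locally_const (g : ℚ ≃o ℚ) (n : ℤ) (x : ℚ) :
    ∃ F : Finset ℚ, ∀ h : ℚ ≃o ℚ, (∀ t ∈ F, h t = g t) → (h ^ n) x = (g ^ n) x := by
  obtain ⟨n, rfl | rfl⟩ := n.eq_nat_or_neg
  · simpa using pow_locally_const g n x
  · obtain ⟨F, hF⟩ := pow_locally_const g n ((g ^ (-(n : ℤ))) x)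
    refine ⟨F, fun h hh => (h ^ n).injective ?_⟩
    rw [hF h hh, ← zpow_natCast, ← zpow_natCast, ← RelIso.mul_apply, ← RelIso.mul_apply,
      ← zpow_add, ← zpow_add]
    simp

/-- Genericity: the first condition. -/
def C1 (a b : ℚ) (s : SignType) : Set (ℚ ≃o ℚ) :=
  {g | (∃ n : ℤ, (g ^ n) b ≤ a) ∨ ∃ c, a < c ∧ c < b ∧ SignType.sign (g c - c) = s}

theorem exists_free (F : Finset ℚ) (s : ℕ → ℚ) (hs : StrictMono s) :
    ∃ N, ∀ f ∈ F, f ≤ s N ∨ s (N + 3) ≤ f := by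
  have : ∀ᶠ n in Filter.atTop, ∀ f ∈ F, f ≤ s n ∨ ∀ m, s m ≤ f := by
    rw [Filter.eventually_all_finset]
    intro f _
    by_cases h : ∀ m, s m ≤ f
    · exact Filter.Eventually.of_forall fun n => Or.inr h
    · push Not at h
      obtain ⟨m, hm⟩ := h
      filter_upwards [Filter.eventually_ge_atTop m] with n hn
      exact Or.inl (hm.le.trans (hs.monotone hn))
  obtain ⟨N, hN⟩ := this.exists
  exact ⟨N, fun f hf => (hN f hf).imp id fun h => h _⟩

theorem exists_sign (l r : ℚ) (h : l < r) (s : SignType) :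
    ∃ c c' : ℚ, l < c ∧ c < r ∧ l < c' ∧ c' < r ∧ SignType.sign (c' - c) = s := by
  obtain ⟨m, h1, h2⟩ := exists_between h
  obtain ⟨m', h3, h4⟩ := exists_between h2
  cases s
  · exact ⟨m, m, h1, h2, h1, h2, by simp⟩
  · exact ⟨m', m, by linarith, h4, h1, h2, by simpa using sign_neg (by linarith : m - m' < 0)⟩
  · exact ⟨m, m', h1, h2, by linarith, h4, by simpa using sign_pos (by linarith : 0 < m' - m)⟩

theorem modify_sign (g : ℚ ≃o ℚ) (F : Finset ℚ) (a b e w : ℚ) (hF : ∀ f ∈ F, f ≤ e ∨ w ≤ f)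
    (h1 : a ≤ max e (g e)) (h2 : max e (g e) < min w (g w)) (h3 : min w (g w) ≤ b)
    (s : SignType) :
    ∃ h : ℚ ≃o ℚ, (∀ x ∈ F, h x = g x) ∧ ∃ c, a < c ∧ c < b ∧ SignType.sign (h c - c) = s := by
  obtain ⟨c, c', k1, k2, k3, k4, k5⟩ := exists_sign _ _ h2 s
  obtain ⟨h, hc, hl, hr⟩ := exists_modify g e w c c' ((le_max_left _ _).trans_lt k1)
    (k2.trans_le (min_le_left _ _)) ((le_max_right _ _).trans_lt k3)
    (k4.trans_le (min_le_right _ _))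
  exact ⟨h, fun x hx => (hF x hx).elim (hl x) (hr x), c, h1.trans_lt k1, k2.trans_le h3,
    by rw [hc, k5]⟩

theorem C1_residual (a b : ℚ) (hab : a < b) (s : SignType) :
    C1 a b s ∈ @residual (ℚ ≃o ℚ) orderAutRatPointwiseTopology := by
  apply mem_residual_aux
  · rintro g (⟨n, hn⟩ | ⟨c, h1, h2, h3⟩)
    · obtain ⟨F, hF⟩ := zpow_locally_const g n b
      exact ⟨F, fun h hh => Or.inl ⟨n, by rwa [hF h hh]⟩⟩
    · refine ⟨{c}, fun h hh => Or.inr ⟨c, h1, h2, ?_⟩⟩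
      rw [hh c (by simp), h3]
  · intro g F
    by_cases hn : ∃ n : ℤ, (g ^ n) b ≤ a
    · exact ⟨g, Or.inl hn, fun _ _ => rfl⟩
    push Not at hn
    have hb : ∀ n : ℤ, (g ^ n) a < b := by
      intro n
      have := (g ^ n).strictMono (hn (-n))
      rwa [← RelIso.mul_apply, ← zpow_add, add_neg_cancel, zpow_zero] at this
    have hgs : ∀ n : ℤ, g ((g ^ n) a) = (g ^ (n + 1)) a := by
      intro n
      rw [← RelIso.mul_apply, ← zpow_one_add, add_comm]
    suffices H : ∃ e w, (∀ f ∈ F, f ≤ e ∨ w ≤ f) ∧ a ≤ max e (g e) ∧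
        max e (g e) < min w (g w) ∧ min w (g w) ≤ b by
      obtain ⟨e, w, hF, h1, h2, h3⟩ := H
      obtain ⟨h, hh, hc⟩ := modify_sign g F a b e w hF h1 h2 h3 s
      exact ⟨h, Or.inr hc, hh⟩
    rcases lt_trichotomy a (g a) with hlt | heq | hgt
    · have hz : StrictMono fun n : ℤ => (g ^ n) a := by
        apply strictMono_int_of_lt_succ
        intro n
        rw [zpow_add_one, RelIso.mul_apply]
        exact (g ^ n).strictMono hlt
      obtain ⟨N, hN⟩ := exists_free F (fun n : ℕ => (g ^ (n : ℤ)) a)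
        (fun m n hmn => hz (by exact_mod_cast hmn))
      refine ⟨_, _, hN, le_max_of_le_left ?_, ?_, (min_le_left _ _).trans (hb _).le⟩
      · have := hz.monotone (Int.natCast_nonneg N)
        simpa using this
      · rw [hgs, hgs]
        simp only [max_lt_iff, lt_min_iff]
        refine ⟨⟨hz ?_, hz ?_⟩, hz ?_, hz ?_⟩ <;> push_cast <;> omega
    · obtain ⟨w, hw1, hw2⟩ : ∃ w, (a < w ∧ w < b) ∧ ∀ f ∈ F, f ≤ a ∨ w ≤ f := by
        by_cases hne : (F.filter (fun f => a < f)).Nonempty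
        · have hm := Finset.min'_mem _ hne
          rw [Finset.mem_filter] at hm
          obtain ⟨w, h1, h2⟩ := exists_between (lt_min hab hm.2)
          refine ⟨w, ⟨h1, h2.trans_le (min_le_left _ _)⟩, fun f hf => ?_⟩
          rcases le_or_gt f a with h | h
          · exact Or.inl h
          · exact Or.inr ((h2.trans_le (min_le_right _ _)).le.trans
              (Finset.min'_le _ _ (Finset.mem_filter.2 ⟨hf, h⟩)))
        · obtain ⟨w, h1, h2⟩ := exists_between hab
          refine ⟨w, ⟨h1, h2⟩, fun f hf => Or.inl (not_lt.1 fun h => hne ⟨f, ?_⟩)⟩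
          exact Finset.mem_filter.2 ⟨hf, h⟩
      refine ⟨a, w, hw2, le_max_left _ _, ?_, (min_le_left _ _).trans hw1.2.le⟩
      rw [← heq, max_self, lt_min_iff]
      refine ⟨hw1.1, ?_⟩
      have := g.strictMono hw1.1
      rwa [← heq] at this
    · have hz : StrictMono fun n : ℤ => (g ^ (-n)) a := by
        apply strictMono_int_of_lt_succ
        intro n
        have := (g ^ (-(n + 1))).strictMono hgt
        rw [← RelIso.mul_apply, ← zpow_add_one] at this
        simpa using this
      obtain ⟨N, hN⟩ := exists_free F (fun n : ℕ => (g ^ (-(n : ℤ))) a)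
        (fun m n hmn => hz (by exact_mod_cast hmn))
      have hz' : ∀ m n : ℤ, n < m → (g ^ m) a < (g ^ n) a := by
        intro m n hmn
        have := hz (neg_lt_neg hmn)
        simpa using this
      refine ⟨_, _, hN, le_max_of_le_left ?_, ?_, (min_le_left _ _).trans (hb _).le⟩
      · have := hz.monotone (Int.natCast_nonneg N)
        simpa using this
      · rw [hgs, hgs]
        simp only [max_lt_iff, lt_min_iff]
        refine ⟨⟨hz' _ _ ?_, hz' _ _ ?_⟩, hz' _ _ ?_, hz' _ _ ?_⟩ <;> push_cast <;> omega

theorem up_residual (a : ℚ) :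
    {g : ℚ ≃o ℚ | ∃ c, a < c ∧ g c = c} ∈ @residual (ℚ ≃o ℚ) orderAutRatPointwiseTopology := by
  apply mem_residual_aux
  · rintro g ⟨c, h1, h2⟩
    exact ⟨{c}, fun h hh => ⟨c, h1, by rw [hh c (by simp), h2]⟩⟩
  · intro g F
    obtain ⟨e, he⟩ := (insert a F).exists_le
    have hw : max e (g e) < min (max (max e (g e)) (g.symm e) + 1)
        (g (max (max e (g e)) (g.symm e) + 1)) := by
      set w := max (max e (g e)) (g.symm e) + 1 with hw
      have h1 : max e (g e) < w := by
        have := le_max_left (max e (g e)) (g.symm e); linarith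
      have h2 : g.symm e < w := by
        have := le_max_right (max e (g e)) (g.symm e); linarith
      exact lt_min h1 (max_lt (by rwa [← g.symm_apply_lt])
        (g.strictMono ((le_max_left _ _).trans_lt h1)))
    obtain ⟨h, hh, c, h1, _, h2⟩ := modify_sign g F a _ e _
      (fun f hf => Or.inl (he f (Finset.mem_insert_of_mem hf)))
      ((he a (Finset.mem_insert_self _ _)).trans (le_max_left _ _)) hw le_rfl 0
    exact ⟨h, ⟨c, h1, by rw [sign_eq_zero_iff] at h2; linarith⟩, hh⟩

theorem down_residual (b : ℚ) :
    {g : ℚ ≃o ℚ | ∃ c, c < b ∧ g c = c} ∈ @residual (ℚ ≃o ℚ) orderAutRatPointwiseTopology := by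
  apply mem_residual_aux
  · rintro g ⟨c, h1, h2⟩
    exact ⟨{c}, fun h hh => ⟨c, h1, by rw [hh c (by simp), h2]⟩⟩
  · intro g F
    obtain ⟨w, hw⟩ : ∃ w, ∀ f ∈ insert b F, w ≤ f := (insert b F).bddBelow
    have hw' : max (min (min w (g w)) (g.symm w) - 1)
        (g (min (min w (g w)) (g.symm w) - 1)) < min w (g w) := by
      set e := min (min w (g w)) (g.symm w) - 1 with he
      have h1 : e < min w (g w) := by
        have := min_le_left (min w (g w)) (g.symm w); linarith
      have h2 : e < g.symm w := by
        have := min_le_right (min w (g w)) (g.symm w); linarith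
      exact max_lt h1 (lt_min (by rwa [← g.lt_symm_apply])
        (g.strictMono (h1.trans_le (min_le_left _ _))))
    obtain ⟨h, hh, c, _, h1, h2⟩ := modify_sign g F _ b _ w
      (fun f hf => Or.inr (hw f (Finset.mem_insert_of_mem hf)))
      le_rfl hw' ((min_le_left _ _).trans (hw b (Finset.mem_insert_self _ _))) 0
    exact ⟨h, ⟨c, h1, by rw [sign_eq_zero_iff] at h2; linarith⟩, hh⟩

/-- The generic automorphisms. -/
structure Gen (g : ℚ ≃o ℚ) : Prop where
  mid : ∀ a b, a < b → ∀ s, g ∈ C1 a b s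
  up : ∀ a, ∃ c, a < c ∧ g c = c
  down : ∀ b, ∃ c, c < b ∧ g c = c

theorem gen_residual :
    {g | Gen g} ∈ @residual (ℚ ≃o ℚ) orderAutRatPointwiseTopology := by
  let := orderAutRatPointwiseTopology
  have h1 : ∀ᶠ g in residual (ℚ ≃o ℚ), ∀ a b : ℚ, ∀ s, a < b → g ∈ C1 a b s := by
    simp only [Filter.eventually_imp_distrib_left, eventually_countable_forall]
    exact fun a b s h => C1_residual a b h s
  have h2 : ∀ᶠ g in residual (ℚ ≃o ℚ), ∀ a : ℚ, ∃ c, a < c ∧ g c = c := by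
    rw [eventually_countable_forall]; exact up_residual
  have h3 : ∀ᶠ g in residual (ℚ ≃o ℚ), ∀ a : ℚ, ∃ c, c < a ∧ g c = c := by
    rw [eventually_countable_forall]; exact down_residual
  filter_upwards [h1, h2, h3] with g k1 k2 k3
  exact ⟨fun a b h s => k1 a b s h, k2, k3⟩

end Top
/-! ### Orbitals -/

section Orb

theorem zpow_add_app (g : ℚ ≃o ℚ) (m n : ℤ) (x : ℚ) : (g ^ (m + n)) x = (g ^ m) ((g ^ n) x) := by
  rw [zpow_add, RelIso.mul_apply]

theorem zpow_neg_le (g : ℚ ≃o ℚ) (n : ℤ) (x y : ℚ) : (g ^ (-n)) x ≤ y ↔ x ≤ (g ^ n) y := by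
  rw [← (g ^ n).le_iff_le, ← zpow_add_app, add_neg_cancel, zpow_zero]; rfl

/-- `ℚ` with the preorder whose antisymmetrization is the order of orbitals of `g`. -/
def OrbPre (_g : ℚ ≃o ℚ) : Type := ℚ

/-- The orbital preorder on `ℚ`. -/
def OrbLe (g : ℚ ≃o ℚ) (x y : ℚ) : Prop := ∃ n : ℤ, (g ^ n) x ≤ y

theorem OrbLe.of_le (g : ℚ ≃o ℚ) {x y : ℚ} (h : x ≤ y) : OrbLe g x y := ⟨0, h⟩

theorem OrbLe.trans {g : ℚ ≃o ℚ} {x y z : ℚ} : OrbLe g x y → OrbLe g y z → OrbLe g x z := by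
  rintro ⟨n, hn⟩ ⟨m, hm⟩
  refine ⟨m + n, ?_⟩
  rw [zpow_add_app]
  exact ((g ^ m).monotone hn).trans hm

instance (g : ℚ ≃o ℚ) : Preorder (OrbPre g) where
  le := OrbLe g
  le_refl _ := OrbLe.of_le g (le_refl (α := ℚ) _)
  le_trans _ _ _ := OrbLe.trans

instance (g : ℚ ≃o ℚ) : @Std.Total (OrbPre g) (· ≤ ·) where
  total x y := (le_total (α := ℚ) x y).imp (OrbLe.of_le g) (OrbLe.of_le g)

instance (g : ℚ ≃o ℚ) : Countable (OrbPre g) := inferInstanceAs (Countable ℚ)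

/-- The set of orbitals. -/
def Orb (g : ℚ ≃o ℚ) : Type := Antisymmetrization (OrbPre g) (· ≤ ·)

open Classical in
noncomputable instance (g : ℚ ≃o ℚ) : LinearOrder (Orb g) :=
  inferInstanceAs (LinearOrder (Antisymmetrization (OrbPre g) (· ≤ ·)))

instance (g : ℚ ≃o ℚ) : Countable (Orb g) :=
  inferInstanceAs (Countable (Quotient _))

/-- The orbital of a point. -/
def orb (g : ℚ ≃o ℚ) (x : ℚ) : Orb g := toAntisymmetrization (α := OrbPre g) (· ≤ ·) x

theorem mk_surj (g : ℚ ≃o ℚ) (q : Orb g) : ∃ x, orb g x = q := Quotient.exists_rep q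

theorem mk_le (g : ℚ ≃o ℚ) {x y : ℚ} : orb g x ≤ orb g y ↔ ∃ n : ℤ, (g ^ n) x ≤ y := Iff.rfl

theorem mk_mono (g : ℚ ≃o ℚ) {x y : ℚ} (h : x ≤ y) : orb g x ≤ orb g y := (mk_le g).2 ⟨0, h⟩

theorem lt_of_mk_lt (g : ℚ ≃o ℚ) {x y : ℚ} (h : orb g x < orb g y) : x < y :=
  not_le.1 fun h' => (mk_mono g h').not_gt h

theorem mk_eq (g : ℚ ≃o ℚ) {x y : ℚ} :
    orb g x = orb g y ↔ (∃ n : ℤ, (g ^ n) x ≤ y) ∧ ∃ n : ℤ, y ≤ (g ^ n) x := by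
  rw [le_antisymm_iff, mk_le, mk_le]
  refine and_congr_right fun _ => ⟨?_, ?_⟩
  · rintro ⟨n, hn⟩
    exact ⟨-n, by rwa [← zpow_neg_le, neg_neg]⟩
  · rintro ⟨n, hn⟩
    exact ⟨-n, by rwa [zpow_neg_le]⟩

theorem mk_zpow (g : ℚ ≃o ℚ) (n : ℤ) (x : ℚ) : orb g ((g ^ n) x) = orb g x :=
  ((mk_eq g).2 ⟨⟨n, le_rfl⟩, ⟨n, le_rfl⟩⟩).symm

theorem mk_app (g : ℚ ≃o ℚ) (x : ℚ) : orb g (g x) = orb g x := by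
  simpa using mk_zpow g 1 x

theorem mk_inv (g : ℚ ≃o ℚ) {x y : ℚ} : orb g⁻¹ x = orb g⁻¹ y ↔ orb g x = orb g y := by
  rw [mk_eq, mk_eq]
  refine and_congr ?_ ?_
  · constructor <;> rintro ⟨n, hn⟩ <;> exact ⟨-n, by simpa using hn⟩
  · constructor <;> rintro ⟨n, hn⟩ <;> exact ⟨-n, by simpa using hn⟩

theorem zpow_fixed {g : ℚ ≃o ℚ} {x : ℚ} (h : g x = x) (n : ℤ) : (g ^ n) x = x := by
  have h' : g⁻¹ x = x := by
    have := RelIso.inv_apply_self g x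
    rwa [h] at this
  induction n with
  | zero => rfl
  | succ n ih => rw [zpow_add_one, RelIso.mul_apply, h, ih]
  | pred n ih => rw [zpow_sub_one, RelIso.mul_apply, h', ih]

theorem mk_eq_fixed {g : ℚ ≃o ℚ} {x y : ℚ} (h : g x = x) : orb g x = orb g y ↔ x = y := by
  rw [mk_eq]
  simp only [zpow_fixed h, exists_const]
  exact ⟨fun h => le_antisymm h.1 h.2, fun h => ⟨h.le, h.ge⟩⟩

theorem strictMono_zpow {g : ℚ ≃o ℚ} {x : ℚ} (h : x < g x) :
    StrictMono fun n : ℤ => (g ^ n) x := by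
  apply strictMono_int_of_lt_succ
  intro n
  rw [zpow_add_one, RelIso.mul_apply]
  exact (g ^ n).strictMono h

theorem exists_floor {g : ℚ ≃o ℚ} {x y : ℚ} (h : x < g x) (hy : orb g x = orb g y) :
    ∃ n : ℤ, (g ^ n) x ≤ y ∧ y < (g ^ (n + 1)) x := by
  obtain ⟨h1, m, hm⟩ := (mk_eq g).1 hy
  obtain ⟨n, hn, hmax⟩ := Int.exists_greatest_of_bdd (P := fun n => (g ^ n) x ≤ y)
    ⟨m, fun z hz => (strictMono_zpow h).le_iff_le.1 (hz.trans hm)⟩ h1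
  refine ⟨n, hn, not_le.1 fun h => ?_⟩
  have := hmax _ h
  omega

theorem floor_unique {g : ℚ ≃o ℚ} {x y : ℚ} (h : x < g x) {m n : ℤ}
    (h1 : (g ^ n) x ≤ y) (h2 : y < (g ^ (n + 1)) x)
    (h3 : (g ^ m) x ≤ y) (h4 : y < (g ^ (m + 1)) x) : m = n := by
  have a := (strictMono_zpow h).lt_iff_lt.1 (h1.trans_lt h4)
  have b := (strictMono_zpow h).lt_iff_lt.1 (h3.trans_lt h2)
  omega

theorem pos_of_mk_eq {g : ℚ ≃o ℚ} {x y : ℚ} (h : x < g x) (hy : orb g x = orb g y) : y < g y := by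
  obtain ⟨n, h1, h2⟩ := exists_floor h hy
  refine h2.trans_le ?_
  rw [add_comm, zpow_add_app, zpow_one]
  exact g.monotone h1

theorem inv_pos {g : ℚ ≃o ℚ} {x : ℚ} : x < g⁻¹ x ↔ g x < x := by
  rw [← g.lt_iff_lt, RelIso.apply_inv_self]

theorem sign_congr {g : ℚ ≃o ℚ} {x y : ℚ} (hy : orb g x = orb g y) :
    SignType.sign (g x - x) = SignType.sign (g y - y) := by
  rcases lt_trichotomy x (g x) with h | h | h
  · have := pos_of_mk_eq h hy
    rw [sign_pos (by linarith), sign_pos (by linarith)]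
  · rw [(mk_eq_fixed h.symm).1 hy]
  · have := inv_pos.1 (pos_of_mk_eq (inv_pos.2 h) ((mk_inv g).2 hy))
    rw [sign_neg (by linarith), sign_neg (by linarith)]

/-- The colour of an orbital. -/
noncomputable def col (g : ℚ ≃o ℚ) (q : Orb g) : SignType :=
  SignType.sign (g (mk_surj g q).choose - (mk_surj g q).choose)

theorem col_mk (g : ℚ ≃o ℚ) (x : ℚ) : col g (orb g x) = SignType.sign (g x - x) :=
  sign_congr (mk_surj g (orb g x)).choose_spec

theorem mk_lt_fixed {g : ℚ ≃o ℚ} {x c : ℚ} (hc : g c = c) (h : x < c) : orb g x < orb g c :=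
  lt_of_le_of_ne (mk_mono g h.le) fun he => h.ne ((mk_eq_fixed hc).1 he.symm).symm

theorem fixed_lt_mk {g : ℚ ≃o ℚ} {x c : ℚ} (hc : g c = c) (h : c < x) : orb g c < orb g x :=
  lt_of_le_of_ne (mk_mono g h.le) fun he => h.ne ((mk_eq_fixed hc).1 he)

theorem Gen.exists_col {g : ℚ ≃o ℚ} (hg : Gen g) {a b : ℚ} (h : orb g a < orb g b) (s : SignType) :
    ∃ c, a < c ∧ c < b ∧ SignType.sign (g c - c) = s :=
  (hg.mid a b (lt_of_mk_lt g h) s).resolve_left fun h' => ((mk_le g).2 h').not_gt h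

theorem Gen.exists_fix {g : ℚ ≃o ℚ} (hg : Gen g) {a b : ℚ} (h : orb g a < orb g b) :
    ∃ c, a < c ∧ c < b ∧ g c = c := by
  obtain ⟨c, h1, h2, h3⟩ := hg.exists_col h 0
  rw [sign_eq_zero_iff, sub_eq_zero] at h3
  exact ⟨c, h1, h2, h3⟩

theorem Gen.exists_mid {g : ℚ ≃o ℚ} (hg : Gen g) {a b : ℚ} (h : orb g a < orb g b) (s : SignType) :
    ∃ c, orb g a < orb g c ∧ orb g c < orb g b ∧ col g (orb g c) = s := by
  obtain ⟨u, u1, u2, u3⟩ := hg.exists_fix h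
  obtain ⟨v, v1, v2, v3⟩ := hg.exists_fix (fixed_lt_mk u3 u2)
  obtain ⟨c, c1, c2, c3⟩ := hg.exists_col (fixed_lt_mk u3 v1) s
  exact ⟨c, (mk_lt_fixed u3 u1).trans (fixed_lt_mk u3 c1),
    (mk_lt_fixed v3 c2).trans (fixed_lt_mk v3 v2), by rw [col_mk, c3]⟩

theorem Gen.rich {g : ℚ ≃o ℚ} (hg : Gen g) : Rich (col g) where
  mid p q hpq k := by
    obtain ⟨a, rfl⟩ := mk_surj g p
    obtain ⟨b, rfl⟩ := mk_surj g q
    obtain ⟨c, h⟩ := hg.exists_mid hpq k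
    exact ⟨_, h⟩
  up p k := by
    obtain ⟨a, rfl⟩ := mk_surj g p
    obtain ⟨b, h1, h2⟩ := hg.up a
    obtain ⟨c, h3, _, h4⟩ := hg.exists_mid (mk_lt_fixed h2 h1) k
    exact ⟨_, h3, h4⟩
  down p k := by
    obtain ⟨a, rfl⟩ := mk_surj g p
    obtain ⟨b, h1, h2⟩ := hg.down a
    obtain ⟨c, _, h3, h4⟩ := hg.exists_mid (fixed_lt_mk h2 h1) k
    exact ⟨_, h3, h4⟩
  ne k := by
    obtain ⟨b, h1, h2⟩ := hg.up 0
    obtain ⟨c, _, _, h4⟩ := hg.exists_mid (mk_lt_fixed h2 h1) k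
    exact ⟨_, h4⟩

/-- `φ` conjugates `g` on the orbital of `x` to `h` on the orbital of `y`. -/
structure LocConj (g h : ℚ ≃o ℚ) (x y : ℚ) (φ : ℚ → ℚ) : Prop where
  mono : ∀ s t, orb g x = orb g s → orb g x = orb g t → s < t → φ s < φ t
  maps : ∀ s, orb g x = orb g s → orb h y = orb h (φ s)
  surj : ∀ u, orb h y = orb h u → ∃ s, orb g x = orb g s ∧ φ s = u
  equi : ∀ s, orb g x = orb g s → φ (g s) = h (φ s)

theorem exists_locConj_pos {g h : ℚ ≃o ℚ} {x y : ℚ} (hx : x < g x) (hy : y < h y) :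
    ∃ φ, LocConj g h x y φ := by
  classical
  obtain ⟨A, A1, A2⟩ := exists_affine x (g x) y (h y) hx hy
  have hfl : ∀ t, ∃ n : ℤ, orb g x = orb g t → (g ^ n) x ≤ t ∧ t < (g ^ (n + 1)) x := by
    intro t
    by_cases ht : orb g x = orb g t
    · obtain ⟨n, hn⟩ := exists_floor hx ht
      exact ⟨n, fun _ => hn⟩
    · exact ⟨0, fun h => absurd h ht⟩
  choose N hN using hfl
  let ψ : ℤ → ℚ ≃o ℚ := fun n => h ^ n * A * g ^ (-n)
  have ψ1 : ∀ n : ℤ, ∀ t, ψ n ((g ^ n) t) = (h ^ n) (A t) := by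
    intro n t
    simp only [ψ, RelIso.mul_apply]
    rw [← zpow_add_app g, neg_add_cancel]
    rfl
  have ψ2 : ∀ n : ℤ, ψ n ((g ^ n) x) = (h ^ n) y := fun n => by rw [ψ1, A1]
  have ψ3 : ∀ n : ℤ, ψ n ((g ^ (n + 1)) x) = (h ^ (n + 1)) y := fun n => by
    rw [zpow_add_app, zpow_one, ψ1, A2, zpow_add_app, zpow_one]
  have ψ4 : ∀ n : ℤ, ∀ t, ψ (n + 1) (g t) = h (ψ n t) := by
    intro n t
    obtain ⟨r, rfl⟩ := (g ^ n).surjective t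
    have : g ((g ^ n) r) = (g ^ (n + 1)) r := by rw [add_comm, zpow_add_app, zpow_one]
    rw [this, ψ1, ψ1, add_comm, zpow_add_app, zpow_one]
  have φ1 : ∀ t, orb g x = orb g t → (h ^ (N t)) y ≤ ψ (N t) t ∧ ψ (N t) t < (h ^ (N t + 1)) y := by
    intro t ht
    rw [← ψ2, ← ψ3]
    exact ⟨(ψ _).monotone (hN t ht).1, (ψ _).strictMono (hN t ht).2⟩
  have hmk : ∀ n : ℤ, ∀ t, (g ^ n) x ≤ t → t < (g ^ (n + 1)) x → orb g x = orb g t :=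
    fun n t h1 h2 => (mk_eq g).2 ⟨⟨n, h1⟩, ⟨n + 1, h2.le⟩⟩
  have hNu : ∀ n : ℤ, ∀ t, (g ^ n) x ≤ t → t < (g ^ (n + 1)) x → N t = n := by
    intro n t h1 h2
    obtain ⟨h3, h4⟩ := hN t (hmk n t h1 h2)
    exact floor_unique hx h1 h2 h3 h4
  refine ⟨fun t => ψ (N t) t, ?_, ?_, ?_, ?_⟩
  · intro s t hs ht hst
    have h1 : N s < N t + 1 :=
      (strictMono_zpow hx).lt_iff_lt.1 ((hN s hs).1.trans_lt (hst.trans (hN t ht).2))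
    rcases (Int.lt_add_one_iff.1 h1).eq_or_lt with h2 | h2
    · simp only [h2]
      exact (ψ _).strictMono hst
    · exact (φ1 s hs).2.trans_le (((strictMono_zpow hy).monotone h2).trans (φ1 t ht).1)
  · intro s hs
    exact (mk_eq h).2 ⟨⟨_, (φ1 s hs).1⟩, ⟨_, (φ1 s hs).2.le⟩⟩
  · intro u hu
    obtain ⟨n, h1, h2⟩ := exists_floor hy hu
    obtain ⟨t, rfl⟩ := (ψ n).surjective u
    rw [← ψ2, (ψ n).le_iff_le] at h1
    rw [← ψ3, (ψ n).lt_iff_lt] at h2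
    exact ⟨t, hmk n t h1 h2, by simp only [hNu n t h1 h2]⟩
  · intro s hs
    obtain ⟨h1, h2⟩ := hN s hs
    have : N (g s) = N s + 1 := by
      apply hNu
      · rw [add_comm, zpow_add_app, zpow_one]; exact g.monotone h1
      · rw [add_comm, zpow_add_app, zpow_one]; exact g.strictMono h2
    simp only [this, ψ4]

theorem exists_locConj {g h : ℚ ≃o ℚ} {x y : ℚ}
    (hs : SignType.sign (h y - y) = SignType.sign (g x - x)) :
    ∃ φ, LocConj g h x y φ := by
  rcases lt_trichotomy x (g x) with hx | hx | hx
  · rw [sign_pos (a := g x - x) (by linarith), sign_eq_one_iff] at hs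
    exact exists_locConj_pos hx (by linarith)
  · rw [← hx, sub_self, sign_zero, sign_eq_zero_iff, sub_eq_zero] at hs
    refine ⟨fun _ => y, ?_, ?_, ?_, ?_⟩
    · intro s t h1 h2 h3
      rw [mk_eq_fixed hx.symm] at h1 h2
      exact absurd (h1.symm.trans h2) h3.ne
    · intro s _; rfl
    · intro u hu
      rw [mk_eq_fixed hs] at hu
      exact ⟨x, rfl, hu⟩
    · intro s _
      exact hs.symm
  · rw [sign_neg (a := g x - x) (by linarith), sign_eq_neg_one_iff] at hs
    obtain ⟨φ, hφ⟩ := exists_locConj_pos (inv_pos.2 hx) (inv_pos.2 (by linarith : h y < y))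
    refine ⟨φ, ?_, ?_, ?_, ?_⟩
    · intro s t h1 h2
      exact hφ.mono s t ((mk_inv g).2 h1) ((mk_inv g).2 h2)
    · intro s h1
      exact (mk_inv h).1 (hφ.maps s ((mk_inv g).2 h1))
    · intro u hu
      obtain ⟨s, h1, h2⟩ := hφ.surj u ((mk_inv h).2 hu)
      exact ⟨s, (mk_inv g).1 h1, h2⟩
    · intro s h1
      have := hφ.equi (g s) ((mk_inv g).2 (by rw [mk_app, h1]))
      rw [RelIso.inv_apply_self] at this
      rw [this, RelIso.apply_inv_self]

theorem Gen.isConj {g h : ℚ ≃o ℚ} (hg : Gen g) (hh : Gen h) : IsConj g h := by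
  obtain ⟨e, he⟩ := exists_colour_iso hg.rich hh.rich
  have hloc : ∀ q : Orb g, ∃ x y φ, orb g x = q ∧ orb h y = e q ∧ LocConj g h x y φ := by
    intro q
    obtain ⟨x, hx⟩ := mk_surj g q
    obtain ⟨y, hy⟩ := mk_surj h (e q)
    have hc := he q
    rw [← hy, ← hx, col_mk, col_mk] at hc
    obtain ⟨φ, hφ⟩ := exists_locConj hc
    exact ⟨x, y, φ, hx, hy, hφ⟩
  choose X Y φ hX hY hφ using hloc
  let f : ℚ → ℚ := fun t => φ (orb g t) t
  have hf : ∀ t, orb h (f t) = e (orb g t) := fun t => by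
    rw [← hY, (hφ (orb g t)).maps t (hX _)]
  have hmono : StrictMono f := by
    intro s t hst
    rcases (mk_mono g hst.le).eq_or_lt with h1 | h1
    · have := (hφ (orb g t)).mono s t (by rw [hX, h1]) (hX _) hst
      simpa only [f, h1] using this
    · apply lt_of_mk_lt h
      rw [hf, hf]
      exact e.strictMono h1
  have hsurj : Function.Surjective f := by
    intro u
    obtain ⟨s, h1, h2⟩ := (hφ (e.symm (orb h u))).surj u (by rw [hY, e.apply_symm_apply])
    rw [hX] at h1
    exact ⟨s, by simpa only [f, ← h1] using h2⟩
  have hequi : ∀ t, f (g t) = h (f t) := by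
    intro t
    simp only [f, mk_app]
    exact (hφ (orb g t)).equi t (hX _)
  let E : ℚ ≃o ℚ := hmono.orderIsoOfSurjective f hsurj
  rw [isConj_iff]
  refine ⟨E, ?_⟩
  rw [mul_inv_eq_iff_eq_mul]
  ext t
  exact hequi t

end Orb

end GenericRat

/-- There is a generic order-automorphism of `ℚ` (Truss): an element of `Aut(ℚ,<)` whose
conjugacy class is comeagre in the topology of pointwise convergence. -/
theorem exists_generic_orderAutomorphism_rat :
    ∃ g : ℚ ≃o ℚ,
      {h : ℚ ≃o ℚ | IsConj g h} ∈ @residual (ℚ ≃o ℚ) orderAutRatPointwiseTopology := by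
  by_cases hne : ∃ g, GenericRat.Gen g
  · obtain ⟨g, hg⟩ := hne
    exact ⟨g, Filter.mem_of_superset GenericRat.gen_residual fun h hh => hg.isConj hh⟩
  · exact ⟨1, Filter.mem_of_superset GenericRat.gen_residual fun h hh => absurd ⟨h, hh⟩ hne⟩
end
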